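/- Assume N ≥ 3 and 1 + 4/(N−2) < p < 1 + 4/(N−3) (for N = 3 this means p > 5). For every integer n ≥ 1 there exist real numbers B_n with 0 < B_n < b_∞ and C_n > 0, and a function u ∈ C²([0,1]) solving (PDE) on (0,1), such that u(0) = C_n, u′(0) = 0, u(1) = B_n, u > 0 on [0,1], and the function ρ ↦ u(ρ)/u_∞(ρ) − 1 has exactly 2n zeros on (0,1). -/

import Mathlib

open Set Filter

noncomputable def alphaP (p : ℝ) : ℝ := 2 / (p - 1)

noncomputable def b0 (p : ℝ) : ℝ := (2 * (p + 1) / (p - 1) ^ 2) ^ ((1 : ℝ) / (p - 1))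

noncomputable def bInf (N : ℕ) (p : ℝ) : ℝ :=
  (alphaP p * ((N : ℝ) - 2 - alphaP p)) ^ (alphaP p / 2)

noncomputable def uInf (N : ℕ) (p : ℝ) (ρ : ℝ) : ℝ := bInf N p * ρ ^ (-(alphaP p))

/-- `u` solves `(1-ρ²)u'' + ((N-1)/ρ - 2(α+1)ρ)u' - α(α+1)u + |u|^{p-1}u = 0` on `s`. -/
def IsSolOn (N : ℕ) (p : ℝ) (u : ℝ → ℝ) (s : Set ℝ) : Prop :=
  ∀ ρ ∈ s,
    (1 - ρ ^ 2) * deriv (deriv u) ρ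
      + (((N : ℝ) - 1) / ρ - 2 * (alphaP p + 1) * ρ) * deriv u ρ
      - alphaP p * (alphaP p + 1) * u ρ + |u ρ| ^ (p - 1) * u ρ = 0

open scoped Topology NNReal

/-- The planar field `(w, z) ↦ (A x * z, -(D x * g w))`. -/
def planarField (A D : ℝ → ℝ) (g : ℝ → ℝ) (x : ℝ) (q : ℝ × ℝ) : ℝ × ℝ :=
  (A x * q.2, -(D x * g q.1))

lemma exists_bound_Icc {A : ℝ → ℝ} (hA : Continuous A) (T : ℝ) :
    ∃ C : ℝ, 0 < C ∧ ∀ x ∈ Icc 0 T, |A x| ≤ C := by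
  obtain ⟨C, hC⟩ := isCompact_Icc.exists_bound_of_continuousOn (hA.continuousOn (s := Icc 0 T))
  exact ⟨max C 1, by positivity, fun x hx => (hC x hx).trans (le_max_left _ _)⟩

lemma lipschitz_planarField {A D g : ℝ → ℝ} {a d : ℝ} {K : ℝ≥0} {x : ℝ} (hg : LipschitzWith K g)
    (ha : |A x| ≤ a) (hd : |D x| ≤ d) :
    LipschitzWith (Real.toNNReal (max a (d * K))) (planarField A D g x) := by
  have hd0 : 0 ≤ d := (abs_nonneg _).trans hd
  have ha0 : 0 ≤ a := (abs_nonneg _).trans ha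
  refine LipschitzWith.of_dist_le_mul fun q r => ?_
  rw [Real.coe_toNNReal _ (le_max_of_le_left ha0), Prod.dist_eq]
  have h1 : dist q.1 r.1 ≤ dist q r := le_max_left _ _
  have h2 : dist q.2 r.2 ≤ dist q r := le_max_right _ _
  have hK := hg.dist_le_mul q.1 r.1
  simp only [planarField]
  refine max_le ?_ ?_
  · rw [Real.dist_eq, ← mul_sub, abs_mul, ← Real.dist_eq]
    exact mul_le_mul (ha.trans (le_max_left _ _)) h2 dist_nonneg (le_max_of_le_left ha0)
  · rw [dist_neg_neg, Real.dist_eq, ← mul_sub, abs_mul, ← Real.dist_eq]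
    calc |D x| * dist (g q.1) (g r.1) ≤ d * (K * dist q.1 r.1) := by gcongr
      _ = (d * K) * dist q.1 r.1 := by ring
      _ ≤ _ := mul_le_mul (le_max_right _ _) h1 dist_nonneg (le_max_of_le_left ha0)

lemma planar_exists_Icc {A D g : ℝ → ℝ} (hA : Continuous A) (hD : Continuous D) {K : ℝ≥0}
    (hg : LipschitzWith K g) {M : ℝ} (hM : ∀ w, |g w| ≤ M) {T : ℝ} (hT : 0 < T) (b : ℝ) :
    ∃ q : ℝ → ℝ × ℝ, q 0 = (b, 0) ∧
      ∀ x ∈ Icc 0 T, HasDerivWithinAt q (planarField A D g x (q x)) (Icc 0 T) x := by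
  obtain ⟨a, ha0, ha⟩ := exists_bound_Icc hA T
  obtain ⟨d, hd0, hd⟩ := exists_bound_Icc hD T
  have hM0 : 0 ≤ M := (abs_nonneg _).trans (hM 0)
  set R : ℝ := d * M * T with hR
  have hR0 : 0 ≤ R := by positivity
  set c : ℝ → ℝ := fun z => max (-R) (min R z) with hc
  have hcl : LipschitzWith 1 c := (LipschitzWith.id.const_min R).const_max (-R)
  have hcb : ∀ z, |c z| ≤ R := fun z => abs_le.2 ⟨le_max_left _ _,
    max_le (by linarith) (min_le_left _ _)⟩
  have hcl2 : LipschitzWith 1 (fun q : ℝ × ℝ => (q.1, c q.2)) := by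
    refine LipschitzWith.of_dist_le_mul fun q r => ?_
    rw [Prod.dist_eq, Prod.dist_eq, NNReal.coe_one, one_mul]
    refine max_le_max le_rfl ?_
    simpa using hcl.dist_le_mul q.2 r.2
  set f : ℝ → ℝ × ℝ → ℝ × ℝ := fun x q => planarField A D g x (q.1, c q.2) with hf
  set L : ℝ := max (a * R) (d * M) with hL
  have hL0 : 0 ≤ L := le_max_of_le_left (by positivity)
  have hPL : IsPicardLindelof f (⟨0, le_rfl, hT.le⟩ : Icc (0:ℝ) T) (b, 0)
      (Real.toNNReal (L * T)) 0 (Real.toNNReal L) (Real.toNNReal (max a (d * K)) * 1) := by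
    refine ⟨fun t ht => ?_, fun q _ => ?_, fun t ht q _ => ?_, ?_⟩
    · exact ((lipschitz_planarField hg (ha t ht) (hd t ht)).comp hcl2).lipschitzOnWith
    · have : Continuous (f · q) := by
        simp only [hf, planarField]; fun_prop
      exact this.continuousOn
    · rw [Real.coe_toNNReal _ hL0, Prod.norm_def]
      simp only [hf, planarField]
      refine max_le_max ?_ ?_
      · rw [norm_mul]
        exact mul_le_mul (ha t ht) (hcb _) (abs_nonneg _) ha0.le
      · rw [norm_neg, norm_mul]
        exact mul_le_mul (hd t ht) (hM _) (abs_nonneg _) hd0.le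
    · rw [Real.coe_toNNReal _ hL0, Real.coe_toNNReal _ (by positivity)]
      simp [hT.le]
  obtain ⟨q, hq0, hq⟩ := hPL.exists_eq_forall_mem_Icc_hasDerivWithinAt₀
  refine ⟨q, hq0, fun x hx => ?_⟩
  have hz : ∀ x ∈ Icc 0 T, HasDerivWithinAt (fun x => (q x).2) (-(D x * g (q x).1)) (Icc 0 T) x :=
    fun x hx => by
      simpa [hf, planarField] using (hq x hx).hasFDerivWithinAt.snd.hasDerivWithinAt
  have hzb : |(q x).2| ≤ R := by
    have := (convex_Icc 0 T).norm_image_sub_le_of_norm_hasDerivWithin_le (C := d * M) hz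
      (fun y hy => by
        rw [norm_neg, norm_mul]
        exact mul_le_mul (hd y hy) (hM _) (abs_nonneg _) hd0.le)
      (left_mem_Icc.2 hT.le) hx
    simp only [hq0, sub_zero, Real.norm_eq_abs] at this
    refine this.trans ?_
    rw [abs_of_nonneg hx.1]
    exact mul_le_mul_of_nonneg_left hx.2 (by positivity)
  have hcq : c (q x).2 = (q x).2 := by
    rw [abs_le] at hzb
    simp only [hc, min_eq_right hzb.2, max_eq_right hzb.1]
  have := hq x hx
  simp only [hf, hcq] at this
  exact this

lemma planar_dist_le {A D g : ℝ → ℝ} {a d : ℝ} {K : ℝ≥0} {T : ℝ} (hg : LipschitzWith K g)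
    (ha : ∀ x ∈ Icc 0 T, |A x| ≤ a) (hd : ∀ x ∈ Icc 0 T, |D x| ≤ d) {q r : ℝ → ℝ × ℝ}
    (hq : ∀ x ∈ Icc 0 T, HasDerivWithinAt q (planarField A D g x (q x)) (Icc 0 T) x)
    (hr : ∀ x ∈ Icc 0 T, HasDerivWithinAt r (planarField A D g x (r x)) (Icc 0 T) x) :
    ∀ x ∈ Icc 0 T, dist (q x) (r x) ≤
      dist (q 0) (r 0) * Real.exp (Real.toNNReal (max a (d * K)) * x) := by
  have hmono : ∀ {q : ℝ → ℝ × ℝ},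
      (∀ x ∈ Icc 0 T, HasDerivWithinAt q (planarField A D g x (q x)) (Icc 0 T) x) →
      ∀ x ∈ Ico 0 T, HasDerivWithinAt q (planarField A D g x (q x)) (Ici x) x := by
    intro q hq x hx
    exact (hq x (Ico_subset_Icc_self hx)).mono_of_mem_nhdsWithin
      (mem_of_superset (Ico_mem_nhdsGE hx.2) fun y hy => ⟨hx.1.trans hy.1, hy.2.le⟩)
  intro x hx
  have := dist_le_of_trajectories_ODE_of_mem (v := planarField A D g) (s := fun _ => univ)
    (K := Real.toNNReal (max a (d * K)))
    (fun t ht => (lipschitz_planarField hg (ha t (Ico_subset_Icc_self ht))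
      (hd t (Ico_subset_Icc_self ht))).lipschitzOnWith)
    (fun x hx => (hq x hx).continuousWithinAt) (hmono hq) (fun _ _ => mem_univ _)
    (fun x hx => (hr x hx).continuousWithinAt) (hmono hr) (fun _ _ => mem_univ _) le_rfl x hx
  simpa using this

/-- Global solutions of the planar system on `[0, ∞)`, locally Lipschitz in the initial value. -/
theorem planar_exists_global {A D g : ℝ → ℝ} (hA : Continuous A) (hD : Continuous D) {K : ℝ≥0}
    (hg : LipschitzWith K g) {M : ℝ} (hM : ∀ w, |g w| ≤ M) :
    ∃ q : ℝ → ℝ → ℝ × ℝ, (∀ b, q b 0 = (b, 0)) ∧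
      (∀ b, ∀ x, 0 < x → HasDerivAt (q b) (planarField A D g x (q b x)) x) ∧
      (∀ b, HasDerivWithinAt (q b) (planarField A D g 0 (q b 0)) (Ici 0) 0) ∧
      (∀ b, g b = 0 → ∀ x, 0 ≤ x → q b x = (b, 0)) ∧
      ∀ T, ∃ C : ℝ≥0, ∀ x ∈ Icc 0 T, ∀ b b', dist (q b x) (q b' x) ≤ C * dist b b' := by
  have h := fun (b : ℝ) (n : ℕ) => planar_exists_Icc hA hD hg hM (T := n + 1) (by positivity) b
  choose s hs0 hs using h
  have huniq : ∀ b (m n : ℕ), m ≤ n → ∀ x ∈ Icc 0 ((m : ℝ) + 1), s b m x = s b n x := by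
    intro b m n hmn x hx
    obtain ⟨a, ha0, ha⟩ := exists_bound_Icc hA (m + 1)
    obtain ⟨d, hd0, hd⟩ := exists_bound_Icc hD (m + 1)
    have hmn' : (m : ℝ) + 1 ≤ n + 1 := by gcongr
    have := planar_dist_le hg ha hd (hs b m)
      (fun x hx => (hs b n x ⟨hx.1, hx.2.trans hmn'⟩).mono (Icc_subset_Icc_right hmn')) x hx
    rw [hs0, hs0, dist_self, zero_mul] at this
    exact dist_le_zero.1 this
  set q : ℝ → ℝ → ℝ × ℝ := fun b x => s b ⌊x⌋₊ x with hqdef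
  have hqs : ∀ b (n : ℕ), ∀ x ∈ Icc 0 ((n : ℝ) + 1), q b x = s b n x := by
    intro b n x hx
    rcases le_total ⌊x⌋₊ n with h | h
    · exact huniq b _ _ h x ⟨hx.1, (Nat.lt_floor_add_one x).le⟩
    · exact (huniq b _ _ h x hx).symm
  have hqd : ∀ b (n : ℕ), ∀ x ∈ Icc 0 ((n : ℝ) + 1),
      HasDerivWithinAt (q b) (planarField A D g x (q b x)) (Icc 0 ((n : ℝ) + 1)) x := by
    intro b n x hx
    rw [hqs b n x hx]
    exact (hs b n x hx).congr (fun y hy => hqs b n y hy) (hqs b n x hx)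
  refine ⟨q, fun b => ?_, fun b x hx => ?_, fun b => ?_, fun b hb x hx => ?_, fun T => ?_⟩
  · simp [hqdef, hs0]
  · exact (hqd b ⌊x⌋₊ x ⟨hx.le, (Nat.lt_floor_add_one x).le⟩).hasDerivAt
      (Icc_mem_nhds hx (Nat.lt_floor_add_one x))
  · have := hqd b 0 0 ⟨le_rfl, by norm_num⟩
    exact this.mono_of_mem_nhdsWithin (by simpa using Icc_mem_nhdsGE (zero_lt_one (α := ℝ)))
  · obtain ⟨a, ha0, ha⟩ := exists_bound_Icc hA (⌊x⌋₊ + 1)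
    obtain ⟨d, hd0, hd⟩ := exists_bound_Icc hD (⌊x⌋₊ + 1)
    have := planar_dist_le hg ha hd (hqd b ⌊x⌋₊) (r := fun _ => (b, 0))
      (fun x hx => by
        have e : planarField A D g x (b, 0) = 0 := by simp [planarField, hb]
        rw [e]
        exact hasDerivWithinAt_const x _ _)
      x ⟨hx, (Nat.lt_floor_add_one x).le⟩
    rw [show q b 0 = (b, 0) by simp [hqdef, hs0], dist_self, zero_mul] at this
    exact dist_le_zero.1 this
  · obtain ⟨a, ha0, ha⟩ := exists_bound_Icc hA (⌊T⌋₊ + 1)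
    obtain ⟨d, hd0, hd⟩ := exists_bound_Icc hD (⌊T⌋₊ + 1)
    refine ⟨Real.toNNReal (Real.exp (Real.toNNReal (max a (d * K)) * T)), fun x hx b b' => ?_⟩
    have hx' : x ∈ Icc 0 ((⌊T⌋₊ : ℝ) + 1) := ⟨hx.1, hx.2.trans (Nat.lt_floor_add_one T).le⟩
    have := planar_dist_le hg ha hd (hqd b ⌊T⌋₊) (hqd b' ⌊T⌋₊) x hx'
    rw [Real.coe_toNNReal _ (Real.exp_nonneg _), mul_comm]
    refine this.trans ?_
    have e : dist (q b 0) (q b' 0) = dist b b' := by simp [hqdef, hs0, Prod.dist_eq]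
    rw [e]
    gcongr
    exact hx.2

/-- A family of trajectories of `w″ = k coth t · w′ - g(w)` on `(0, ∞)` with `w(0) = b` which are
regular at `t = 0`; here `y = w′`. -/
structure IsFlow (k : ℝ) (g : ℝ → ℝ) (w y : ℝ → ℝ → ℝ) : Prop where
  continuous_w : Continuous (Function.uncurry w)
  continuous_y : Continuous (Function.uncurry y)
  w_zero : ∀ b, w b 0 = b
  y_zero : ∀ b, y b 0 = 0
  deriv_w : ∀ b t, 0 < t → HasDerivAt (w b) (y b t) t
  deriv_y : ∀ b t, 0 < t →
    HasDerivAt (y b) (k * (Real.cosh t / Real.sinh t) * y b t - g (w b t)) t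
  const : ∀ b, g b = 0 → ∀ t, 0 ≤ t → w b t = b
  regular : ∀ b, Tendsto (fun t => y b t / t) (𝓝[>] 0) (𝓝 (-g b / (1 - k)))

lemma hasDerivAt_sinh_rpow {t : ℝ} (ht : 0 < t) (s : ℝ) :
    HasDerivAt (fun t => Real.sinh t ^ s) (s * Real.sinh t ^ (s - 1) * Real.cosh t) t := by
  have hs : 0 < Real.sinh t := Real.sinh_pos_iff.2 ht
  have := (Real.hasDerivAt_sinh t).rpow_const (p := s) (Or.inl hs.ne')
  convert! this using 1
  ring

theorem exists_isFlow {k : ℝ} (hk : 0 < k) (hk1 : k < 1) {g : ℝ → ℝ} {K : ℝ≥0}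
    (hg : LipschitzWith K g) {M : ℝ} (hM : ∀ w, |g w| ≤ M) :
    ∃ w y : ℝ → ℝ → ℝ, IsFlow k g w y := by
  have hk' : 0 < 1 - k := by linarith
  set γ : ℝ := 1 / (1 - k) with hγ
  have hγ0 : 0 < γ := by positivity
  set A : ℝ → ℝ := fun x => γ * |x| ^ (2 * γ * k) / √(1 + |x| ^ (2 * γ)) with hAdef
  set D : ℝ → ℝ := fun x => γ / √(1 + |x| ^ (2 * γ)) with hDdef
  have hpos : ∀ x : ℝ, √(1 + |x| ^ (2 * γ)) ≠ 0 := fun x => by positivity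
  have hden : Continuous fun x : ℝ => √(1 + |x| ^ (2 * γ)) :=
    (continuous_const.add (continuous_abs.rpow_const fun x => Or.inr (by positivity))).sqrt
  have hA : Continuous A :=
    (continuous_const.mul (continuous_abs.rpow_const fun x => Or.inr (by positivity))).div hden hpos
  have hD : Continuous D := continuous_const.div hden hpos
  obtain ⟨q, hq0, hqd, hqd0, hqk, hql⟩ := planar_exists_global hA hD hg hM
  have hqc : ∀ b, ContinuousOn (q b) (Ici 0) := by
    intro b x hx
    rcases eq_or_lt_of_le (mem_Ici.1 hx) with h | h
    · subst h; exact (hqd0 b).continuousWithinAt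
    · exact (hqd b x h).continuousAt.continuousWithinAt
  set σ : ℝ → ℝ := fun t => Real.sinh (max t 0) ^ (1 - k) with hσ
  have hσc : Continuous σ :=
    (Real.continuous_sinh.comp (continuous_id.max continuous_const)).rpow_const
      fun x => Or.inr hk'.le
  have hsinh0 : ∀ t : ℝ, 0 ≤ Real.sinh (max t 0) :=
    fun t => Real.sinh_nonneg_iff.2 (le_max_right _ _)
  have hσ0 : ∀ t, 0 ≤ σ t := fun t => Real.rpow_nonneg (hsinh0 t) _
  have hQ : Continuous (fun p : ℝ × ℝ => q p.1 (max p.2 0)) := by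
    rw [continuous_iff_continuousAt]
    rintro ⟨b, x⟩
    obtain ⟨C, hC⟩ := hql (max (x + 1) 0)
    have h := continuousOn_prod_of_continuousOn_lipschitzOnWith
      (s := (univ : Set ℝ)) (t := Iic (x + 1)) (fun p : ℝ × ℝ => q p.1 (max p.2 0)) C
      (fun b _ => (hqc b).comp (continuous_id.max continuous_const).continuousOn
        fun x _ => mem_Ici.2 (le_max_right _ _))
      (fun y hy => (LipschitzWith.of_dist_le_mul fun b b' =>
        hC (max y 0) ⟨le_max_right _ _, max_le_max hy le_rfl⟩ b b').lipschitzOnWith)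
    exact h.continuousAt (prod_mem_nhds univ_mem (Iic_mem_nhds (by simp)))
  have hqσ : Continuous (fun p : ℝ × ℝ => q p.1 (σ p.2)) := by
    have : Continuous (fun p : ℝ × ℝ => (p.1, σ p.2)) :=
      continuous_fst.prodMk (hσc.comp continuous_snd)
    convert hQ.comp this using 2 with p
    simp [hσ0 p.2]
  have hσt : ∀ t, 0 < t → σ t = Real.sinh t ^ (1 - k) := fun t ht => by simp [hσ, ht.le]
  have hσd : ∀ t, 0 < t → HasDerivAt σ ((1 - k) * Real.sinh t ^ (-k) * Real.cosh t) t := by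
    intro t ht
    have h := hasDerivAt_sinh_rpow ht (1 - k)
    rw [show 1 - k - 1 = -k by ring] at h
    exact h.congr_of_eventuallyEq (Filter.eventually_of_mem (Ioi_mem_nhds ht) fun s hs => hσt s hs)
  have hkey : ∀ b t, 0 < t → HasDerivAt (fun t => q b (σ t))
      ((Real.sinh t ^ k * (q b (σ t)).2, -(Real.sinh t ^ (-k) * g (q b (σ t)).1))) t := by
    intro b t ht
    have hs : 0 < Real.sinh t := Real.sinh_pos_iff.2 ht
    have hσp : 0 < σ t := by rw [hσt t ht]; positivity
    have h := (hqd b _ hσp).scomp t (hσd t ht)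
    have e1 : |σ t| ^ (2 * γ) = Real.sinh t ^ 2 := by
      rw [abs_of_pos hσp, hσt t ht, ← Real.rpow_mul hs.le, hγ,
        show (1 - k) * (2 * (1 / (1 - k))) = (2 : ℕ) by field_simp; norm_num, Real.rpow_natCast]
    have e2 : |σ t| ^ (2 * γ * k) = Real.sinh t ^ k * Real.sinh t ^ k := by
      rw [abs_of_pos hσp, hσt t ht, ← Real.rpow_mul hs.le, ← Real.rpow_add hs, hγ]
      congr 1
      field_simp
      ring
    have e3 : √(1 + Real.sinh t ^ 2) = Real.cosh t := by
      rw [← Real.cosh_sq', Real.sqrt_sq (Real.cosh_pos t).le]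
    have e4 : Real.sinh t ^ (-k) = (Real.sinh t ^ k)⁻¹ := Real.rpow_neg hs.le k
    have hsk : 0 < Real.sinh t ^ k := by positivity
    have hc := Real.cosh_pos t
    convert! h using 1
    simp only [planarField, hAdef, hDdef, e1, e2, e3, Prod.smul_mk, smul_eq_mul, e4]
    ext
    · rw [hγ]
      field_simp
    · rw [hγ]
      field_simp
  refine ⟨fun b t => (q b (σ t)).1, fun b t => Real.sinh (max t 0) ^ k * (q b (σ t)).2,
    ?_, ?_, ?_, ?_, ?_, ?_, fun b hb t _ => by simp [hqk b hb (σ t) (hσ0 t)], ?_⟩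
  · exact continuous_fst.comp hqσ
  · refine Continuous.mul ?_ (continuous_snd.comp hqσ)
    exact (Real.continuous_sinh.comp (continuous_snd.max continuous_const)).rpow_const
      fun x => Or.inr hk.le
  · intro b; simp [hσ, hk'.ne', hq0]
  · intro b; simp [hk.ne']
  · intro b t ht
    have := (hkey b t ht).hasFDerivAt.fst.hasDerivAt
    simpa [ht.le] using this
  · intro b t ht
    have hs : 0 < Real.sinh t := Real.sinh_pos_iff.2 ht
    have hsk : 0 < Real.sinh t ^ k := by positivity
    have h2 : HasDerivAt (fun t => (q b (σ t)).2) (-(Real.sinh t ^ (-k) * g (q b (σ t)).1)) t := by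
      simpa using (hkey b t ht).hasFDerivAt.snd.hasDerivAt
    have h := (hasDerivAt_sinh_rpow ht k).mul h2
    have h' : HasDerivAt (fun t => Real.sinh (max t 0) ^ k * (q b (σ t)).2) _ t :=
      h.congr_of_eventuallyEq (Filter.eventually_of_mem (Ioi_mem_nhds ht)
        fun s (hs : 0 < s) => by simp [hs.le])
    convert! h' using 1
    rw [Real.rpow_neg hs.le, Real.rpow_sub_one hs.ne', max_eq_left ht.le]
    field_simp
    ring
  · intro b
    have hz : HasDerivWithinAt (fun x => (q b x).2) (-(γ * g b)) (Ici 0) 0 := by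
      have := (hqd0 b).hasFDerivWithinAt.snd.hasDerivWithinAt
      simpa [planarField, hDdef, hq0, hγ0.ne'] using this
    have h1 := hasDerivWithinAt_iff_tendsto_slope.1 hz
    have hσ1 : Tendsto σ (𝓝[>] 0) (𝓝[Ici 0 \ {0}] 0) := by
      refine tendsto_nhdsWithin_iff.2 ⟨?_, ?_⟩
      · have := hσc.tendsto 0
        simp only [hσ, max_self, Real.sinh_zero, Real.zero_rpow hk'.ne'] at this
        exact this.mono_left nhdsWithin_le_nhds
      · filter_upwards [self_mem_nhdsWithin] with t ht
        have hs : 0 < Real.sinh t := Real.sinh_pos_iff.2 ht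
        have : 0 < σ t := by rw [hσt t ht]; positivity
        exact ⟨this.le, this.ne'⟩
    have h2 := h1.comp hσ1
    have h3 : Tendsto (fun t => Real.sinh t / t) (𝓝[>] 0) (𝓝 1) := by
      have := hasDerivAt_iff_tendsto_slope.1 (Real.hasDerivAt_sinh 0)
      rw [Real.cosh_zero] at this
      refine (this.mono_left (nhdsWithin_mono _ fun t (ht : 0 < t) => ht.ne')).congr fun t => ?_
      simp [slope_def_field]
    have h4 := h3.mul h2
    rw [one_mul] at h4
    have e : -(γ * g b) = -g b / (1 - k) := by rw [hγ]; ring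
    rw [e] at h4
    refine h4.congr' ?_
    filter_upwards [self_mem_nhdsWithin] with t ht
    have ht : 0 < t := ht
    have hs : 0 < Real.sinh t := Real.sinh_pos_iff.2 ht
    have hsk : 0 < Real.sinh t ^ k := by positivity
    simp only [Function.comp, slope_def_field, hq0, sub_zero]
    rw [hσt t ht, Real.rpow_sub hs, Real.rpow_one, max_eq_left ht.le]
    field_simp

/-- A truncated double-well type nonlinearity `g` with primitive `G`, positive zero `W` and
energy barrier `M`. -/
structure IsWell (g G : ℝ → ℝ) (W M : ℝ) : Prop where
  W_pos : 0 < W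
  lip : ∃ K, LipschitzWith K g
  deriv_G : ∀ x, HasDerivAt G (g x) x
  G_zero : G 0 = 0
  g_nonpos : ∀ x ≤ 0, g x = 0
  g_neg : ∀ x, 0 < x → x < W → g x < 0
  g_pos : ∀ x, W < x → 0 < g x
  G_pos : ∀ x, M ≤ x → 0 < G x
  near : ∃ δ > 0, ∀ v, |v| ≤ δ → v ^ 2 ≤ g (W + v) * v

namespace IsWell

variable {g G : ℝ → ℝ} {W M : ℝ}

lemma continuous_g (H : IsWell g G W M) : Continuous g := by
  obtain ⟨K, hK⟩ := H.lip
  exact hK.continuous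

lemma continuous_G (H : IsWell g G W M) : Continuous G :=
  continuous_iff_continuousAt.2 fun x => (H.deriv_G x).continuousAt

lemma g_W (H : IsWell g G W M) : g W = 0 := by
  refine le_antisymm ?_ ?_
  · have : Tendsto g (𝓝[<] W) (𝓝 (g W)) := (H.continuous_g.tendsto W).mono_left nhdsWithin_le_nhds
    refine le_of_tendsto this ?_
    filter_upwards [Ioo_mem_nhdsLT H.W_pos] with x hx using (H.g_neg x hx.1 hx.2).le
  · have : Tendsto g (𝓝[>] W) (𝓝 (g W)) := (H.continuous_g.tendsto W).mono_left nhdsWithin_le_nhds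
    refine ge_of_tendsto this ?_
    filter_upwards [self_mem_nhdsWithin] with x hx using (H.g_pos x hx).le

lemma G_anti (H : IsWell g G W M) : StrictAntiOn G (Icc 0 W) := by
  refine strictAntiOn_of_deriv_neg (convex_Icc 0 W) H.continuous_G.continuousOn fun x hx => ?_
  rw [interior_Icc] at hx
  rw [(H.deriv_G x).deriv]
  exact H.g_neg x hx.1 hx.2

lemma G_neg (H : IsWell g G W M) {x : ℝ} (hx : 0 < x) (hxW : x ≤ W) : G x < 0 := by
  rw [← H.G_zero]
  exact H.G_anti ⟨le_rfl, H.W_pos.le⟩ ⟨hx.le, hxW⟩ hx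

lemma sign_g (H : IsWell g G W M) {σ x : ℝ} (hσ : σ = 1 ∨ σ = -1) (hx : 0 < x)
    (h : σ * (x - W) < 0) : σ * g x < 0 := by
  rcases hσ with rfl | rfl
  · have := H.g_neg x hx (by linarith)
    linarith
  · have := H.g_pos x (by linarith)
    linarith

end IsWell

namespace IsFlow

variable {k : ℝ} {g G : ℝ → ℝ} {w y : ℝ → ℝ → ℝ} {W M : ℝ}

lemma cont_w (F : IsFlow k g w y) (b : ℝ) : Continuous (w b) :=
  F.continuous_w.comp (Continuous.prodMk_right b)

lemma cont_y (F : IsFlow k g w y) (b : ℝ) : Continuous (y b) :=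
  F.continuous_y.comp (Continuous.prodMk_right b)

/-- The energy `w′²/2 + G(w)`. -/
noncomputable def energy (G : ℝ → ℝ) (w y : ℝ → ℝ → ℝ) (b t : ℝ) : ℝ := y b t ^ 2 / 2 + G (w b t)

lemma continuous_energy (F : IsFlow k g w y) (H : IsWell g G W M) :
    Continuous (Function.uncurry (energy G w y)) := by
  have h1 := F.continuous_w
  have h2 := F.continuous_y
  exact ((h2.pow 2).div_const 2).add (H.continuous_G.comp h1)

lemma hasDerivAt_energy (F : IsFlow k g w y) (H : IsWell g G W M) (b : ℝ) {t : ℝ} (ht : 0 < t) :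
    HasDerivAt (energy G w y b) (k * (Real.cosh t / Real.sinh t) * y b t ^ 2) t := by
  have h1 := ((F.deriv_y b t ht).pow 2).div_const 2
  have h2 := (H.deriv_G (w b t)).comp t (F.deriv_w b t ht)
  convert! h1.add h2 using 1
  simp
  ring

lemma energy_mono (F : IsFlow k g w y) (H : IsWell g G W M) (hk : 0 < k) (b : ℝ) :
    MonotoneOn (energy G w y b) (Ici 0) := by
  have hc : Continuous (energy G w y b) :=
    (F.continuous_energy H).comp (Continuous.prodMk_right b)
  refine monotoneOn_of_deriv_nonneg (convex_Ici 0) hc.continuousOn ?_ ?_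
  · intro t ht
    rw [interior_Ici] at ht
    exact (F.hasDerivAt_energy H b ht).differentiableAt.differentiableWithinAt
  · intro t ht
    rw [interior_Ici] at ht
    rw [(F.hasDerivAt_energy H b ht).deriv]
    have h1 : 0 < Real.sinh t := Real.sinh_pos_iff.2 ht
    have h2 := Real.cosh_pos t
    positivity

/-- Trajectories cannot reach an equilibrium in positive time. -/
lemma eq_of_equilibrium (F : IsFlow k g w y) (H : IsWell g G W M) {b t : ℝ} (ht : 0 < t)
    (hy : y b t = 0) (hg : g (w b t) = 0) : w b t = b := by
  obtain ⟨K, hK⟩ := H.lip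
  have key : ∀ ε ∈ Ioo 0 t, w b ε = w b t := by
    intro ε hε
    set v : ℝ → ℝ × ℝ → ℝ × ℝ := fun s q =>
      (q.2, k * (Real.cosh s / Real.sinh s) * q.2 - g q.1) with hv
    have hcont : ContinuousOn (fun s => k * (Real.cosh s / Real.sinh s)) (Icc ε t) := by
      refine continuousOn_const.mul (Real.continuous_cosh.continuousOn.div
        Real.continuous_sinh.continuousOn fun s hs => ?_)
      exact (Real.sinh_pos_iff.2 (hε.1.trans_le hs.1)).ne'
    obtain ⟨C, hC⟩ := isCompact_Icc.exists_bound_of_continuousOn hcont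
    have hC0 : 0 ≤ C := (norm_nonneg _).trans (hC t ⟨hε.2.le, le_rfl⟩)
    have hLip : ∀ s ∈ Ioc ε t, LipschitzOnWith (Real.toNNReal (1 + C + K)) (v s) univ := by
      intro s hs
      refine (LipschitzWith.of_dist_le_mul fun q r => ?_).lipschitzOnWith
      rw [Real.coe_toNNReal _ (by positivity)]
      have h1 : dist q.1 r.1 ≤ dist q r := le_max_left _ _
      have h2 : dist q.2 r.2 ≤ dist q r := le_max_right _ _
      have h3 := hK.dist_le_mul q.1 r.1
      have h4 := hC s (Ioc_subset_Icc_self hs)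
      have h0 : 0 ≤ dist q r := dist_nonneg
      rw [Prod.dist_eq (x := v s q)]
      refine max_le ?_ ?_
      · refine h2.trans ?_
        have : 0 ≤ (C + K) * dist q r := by positivity
        linarith
      · have h5 : dist (v s q).2 (v s r).2 ≤ C * dist q.2 r.2 + K * dist q.1 r.1 := by
          simp only [hv]
          rw [Real.dist_eq]
          have e : k * (Real.cosh s / Real.sinh s) * q.2 - g q.1 -
              (k * (Real.cosh s / Real.sinh s) * r.2 - g r.1) =
              k * (Real.cosh s / Real.sinh s) * (q.2 - r.2) - (g q.1 - g r.1) := by ring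
          rw [e]
          refine (abs_sub _ _).trans (add_le_add ?_ h3)
          rw [abs_mul]
          exact mul_le_mul_of_nonneg_right h4 (abs_nonneg _)
        have h6 : C * dist q.2 r.2 ≤ C * dist q r := by gcongr
        have h7 : (K : ℝ) * dist q.1 r.1 ≤ K * dist q r := by gcongr
        linarith
    have h := ODE_solution_unique_of_mem_Icc_left (v := v) (s := fun _ => univ) (a := ε) (b := t)
      (f := fun s => (w b s, y b s)) (g := fun _ => (w b t, 0)) hLip
      ((F.cont_w b).prodMk (F.cont_y b)).continuousOn
      (fun s hs => ((F.deriv_w b s (hε.1.trans hs.1)).prodMk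
        (F.deriv_y b s (hε.1.trans hs.1))).hasDerivWithinAt)
      (fun _ _ => mem_univ _) continuousOn_const
      (fun s hs => by
        have e : v s (w b t, 0) = 0 := by simp [hv, hg]
        rw [e]
        exact hasDerivWithinAt_const s _ _)
      (fun _ _ => mem_univ _) (by simp [hy])
    have := h (left_mem_Icc.2 hε.2.le)
    exact congrArg Prod.fst this
  have h1 : Tendsto (w b) (𝓝[>] 0) (𝓝 b) := by
    have := (F.cont_w b).tendsto 0
    rw [F.w_zero] at this
    exact this.mono_left nhdsWithin_le_nhds
  refine tendsto_nhds_unique (Tendsto.congr' ?_ tendsto_const_nhds) h1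
  filter_upwards [Ioo_mem_nhdsGT ht] with s hs using (key s hs).symm

variable {b : ℝ}

lemma critical_pos (F : IsFlow k g w y) (H : IsWell g G W M) (hb : b ∈ Ioo 0 W) {t : ℝ}
    (ht : 0 ≤ t) (hy : y b t = 0) : 0 < w b t := by
  rcases ht.eq_or_lt with rfl | ht
  · rw [F.w_zero]; exact hb.1
  · by_contra! h
    have := F.eq_of_equilibrium H ht hy (H.g_nonpos _ h)
    linarith [hb.1]

lemma critical_ne (F : IsFlow k g w y) (H : IsWell g G W M) (hb : b ∈ Ioo 0 W) {t : ℝ}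
    (ht : 0 ≤ t) (hy : y b t = 0) : w b t ≠ W := by
  rcases ht.eq_or_lt with rfl | ht
  · rw [F.w_zero]; exact hb.2.ne
  · intro h
    have := F.eq_of_equilibrium H ht hy (by rw [h, H.g_W])
    linarith [hb.2]

lemma pos_of_energy_nonpos (F : IsFlow k g w y) (H : IsWell g G W M) (hk : 0 < k)
    (hb : b ∈ Ioo 0 W) {t : ℝ} (ht : 0 ≤ t) (hE : energy G w y b t ≤ 0) : 0 < w b t := by
  by_contra! h
  obtain ⟨s, hs, hs0⟩ : (0 : ℝ) ∈ w b '' Icc 0 t :=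
    intermediate_value_Icc' ht (F.cont_w b).continuousOn ⟨h, by rw [F.w_zero]; exact hb.1.le⟩
  have h1 := F.energy_mono H hk b (mem_Ici.2 hs.1) (mem_Ici.2 ht) hs.2
  have h2 : energy G w y b s = y b s ^ 2 / 2 := by simp [energy, hs0, H.G_zero]
  have h3 : y b s = 0 := by
    have : y b s ^ 2 = 0 := le_antisymm (by linarith) (sq_nonneg _)
    simpa using this
  exact (F.critical_pos H hb hs.1 h3).ne' hs0

lemma lt_of_energy_nonpos (H : IsWell g G W M) {t : ℝ}
    (hE : energy G w y b t ≤ 0) : w b t < M := by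
  by_contra! h
  have h1 := H.G_pos _ h
  have h2 : G (w b t) ≤ energy G w y b t := by
    have := sq_nonneg (y b t)
    simp only [energy]; linarith
  linarith

lemma eventually_sign (F : IsFlow k g w y) (H : IsWell g G W M) (hk1 : k < 1)
    (hb : b ∈ Ioo 0 W) {t σ : ℝ} (hσ : σ = 1 ∨ σ = -1) (ht : 0 ≤ t) (hy : y b t = 0)
    (hw : σ * (w b t - W) < 0) : ∀ᶠ s in 𝓝[>] t, 0 < σ * y b s := by
  have hwp := F.critical_pos H hb ht hy
  have hg := H.sign_g hσ hwp hw
  obtain ⟨c, hc, hlim⟩ : ∃ c, 0 < σ * c ∧ Tendsto (fun s => y b s / (s - t)) (𝓝[>] t) (𝓝 c) := by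
    rcases ht.eq_or_lt with rfl | ht
    · refine ⟨_, ?_, by simpa using F.regular b⟩
      rw [F.w_zero] at hg
      have : 0 < 1 - k := by linarith
      rw [mul_div_assoc', mul_neg]
      exact div_pos (by linarith) this
    · refine ⟨-g (w b t), by linarith, ?_⟩
      have h := F.deriv_y b t ht
      rw [hy, mul_zero, zero_sub] at h
      have h2 := (hasDerivAt_iff_tendsto_slope.1 h).mono_left
        (nhdsWithin_mono t (s := Ioi t) fun s (hs : t < s) => hs.ne')
      refine h2.congr fun s => ?_
      rw [slope_def_field, hy, sub_zero]
  have h1 : Tendsto (fun s => σ * (y b s / (s - t))) (𝓝[>] t) (𝓝 (σ * c)) := hlim.const_mul σ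
  filter_upwards [h1.eventually_const_lt hc, self_mem_nhdsWithin] with s hs hts
  have : 0 < s - t := sub_pos.2 hts
  rw [mul_div_assoc'] at hs
  exact (div_pos_iff_of_pos_right this).1 hs

/-- Between consecutive critical points the trajectory crosses `W`. -/
lemma exists_next_critical (F : IsFlow k g w y) (H : IsWell g G W M) (hk1 : k < 1)
    (hb : b ∈ Ioo 0 W) {t t₁ σ : ℝ} (hσ : σ = 1 ∨ σ = -1) (ht : 0 ≤ t) (hy : y b t = 0)
    (hw : σ * (w b t - W) < 0) (ht₁ : t < t₁) (hy₁ : y b t₁ = 0) :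
    ∃ t' ∈ Ioc t t₁, y b t' = 0 ∧ (∀ s ∈ Ioo t t', 0 < σ * y b s) ∧ 0 < σ * (w b t' - W) := by
  obtain ⟨r, hr, hr'⟩ := (mem_nhdsGT_iff_exists_Ioo_subset).1
    (F.eventually_sign H hk1 hb hσ ht hy hw)
  have hr : t < r := hr
  have hrt₁ : r ≤ t₁ := by
    by_contra! h
    have : 0 < σ * y b t₁ := hr' ⟨ht₁, h⟩
    simp [hy₁] at this
  set S : Set ℝ := Icc r t₁ ∩ (y b) ⁻¹' {0} with hS
  have hSc : IsCompact S := isCompact_Icc.inter_right (isClosed_singleton.preimage (F.cont_y b))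
  have hSn : S.Nonempty := ⟨t₁, ⟨hrt₁, le_rfl⟩, hy₁⟩
  have hmem := hSc.sInf_mem hSn
  set t' := sInf S
  have hy' : y b t' = 0 := hmem.2
  have htt' : t < t' := hr.trans_le hmem.1.1
  have hpos : ∀ s ∈ Ioo t t', 0 < σ * y b s := by
    intro s hs
    by_contra! hneg
    set m := (t + min r s) / 2
    have hms : t < min r s := lt_min hr hs.1
    have hm1 : t < m := by simp only [m]; linarith
    have hm2 : m < r := by have := min_le_left r s; simp only [m]; linarith
    have hm3 : m ≤ s := by have := min_le_right r s; simp only [m]; linarith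
    have hmp : 0 < σ * y b m := hr' ⟨hm1, hm2⟩
    obtain ⟨z, hz, hz0⟩ : (0 : ℝ) ∈ (fun x => σ * y b x) '' Icc m s :=
      intermediate_value_Icc' hm3 (continuous_const.mul (F.cont_y b)).continuousOn ⟨hneg, hmp.le⟩
    have hrz : r ≤ z := by
      by_contra! h
      have : 0 < σ * y b z := hr' ⟨hm1.trans_le hz.1, h⟩
      exact this.ne' hz0
    have hyz : y b z = 0 := by
      rcases hσ with rfl | rfl <;> simpa using hz0
    have : t' ≤ z := csInf_le hSc.bddBelow ⟨⟨hrz, hz.2.trans (hs.2.le.trans hmem.1.2)⟩, hyz⟩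
    linarith [hz.2, hs.2]
  refine ⟨t', ⟨htt', hmem.1.2⟩, hy', hpos, ?_⟩
  have ht'0 : 0 < t' := ht.trans_lt htt'
  by_contra! hle
  have hne := F.critical_ne H hb ht'0.le hy'
  have hlt : σ * (w b t' - W) < 0 := by
    refine lt_of_le_of_ne hle ?_
    rcases hσ with rfl | rfl
    · simpa [sub_eq_zero] using hne
    · simpa [sub_eq_zero] using hne.symm
  have hg := H.sign_g hσ (F.critical_pos H hb ht'0.le hy') hlt
  have h := (F.deriv_y b t' ht'0).const_mul σ
  rw [hy', mul_zero, zero_sub] at h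
  have h2 := (hasDerivAt_iff_tendsto_slope.1 h).mono_left
    (nhdsWithin_mono t' (s := Iio t') fun s (hs : s < t') => hs.ne)
  have h3 : σ * -g (w b t') ≤ 0 := by
    refine le_of_tendsto h2 ?_
    filter_upwards [Ioo_mem_nhdsLT htt'] with s hs
    rw [slope_def_field, hy', mul_zero, sub_zero]
    exact div_nonpos_of_nonneg_of_nonpos (hpos s hs).le (by linarith [hs.2])
  linarith

lemma strictMonoOn_of_sign (F : IsFlow k g w y) {D : Set ℝ} {σ : ℝ} (hD : Convex ℝ D)
    (hD0 : ∀ s ∈ D, 0 ≤ s) (h : ∀ s ∈ interior D, 0 < σ * y b s) :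
    StrictMonoOn (fun s => σ * (w b s - W)) D := by
  refine strictMonoOn_of_deriv_pos hD
    (continuous_const.mul ((F.cont_w b).sub continuous_const)).continuousOn fun s hs => ?_
  have hs0 : 0 < s := by
    have : s ∈ interior (Ici (0 : ℝ)) := interior_mono (fun x hx => hD0 x hx) hs
    simpa using this
  rw [(((F.deriv_w b s hs0).sub_const W).const_mul σ).deriv]
  exact h s hs

/-- A trajectory leaving the vicinity of `0` has enough energy not to turn before `W` again. -/
lemma exists_no_return (F : IsFlow k g w y) (H : IsWell g G W M) (hk : 0 < k) (hk1 : k < 1) :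
    ∃ η > 0, η < W ∧ ∀ b ∈ Ioo 0 W, ∀ t, 0 ≤ t → y b t = 0 → w b t ≤ η →
      ∀ t' > t, y b t' = 0 → W ≤ w b t' := by
  have hW := H.W_pos
  have hGn : G (W / 2) < 0 := H.G_neg (by linarith) (by linarith)
  set y₀ : ℝ := √(-G (W / 2)) with hy₀
  have hy₀p : 0 < y₀ := Real.sqrt_pos.2 (by linarith)
  have hy₀s : y₀ ^ 2 = -G (W / 2) := Real.sq_sqrt (by linarith)
  have hev : ∀ᶠ η in 𝓝[>] (0 : ℝ), G (W / 2) / 2 < G η ∧ -(k * y₀ * (W / 2)) < G η ∧ η < W / 2 := by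
    have hlim : Tendsto G (𝓝[>] 0) (𝓝 0) := by
      have := H.continuous_G.tendsto 0
      rw [H.G_zero] at this
      exact this.mono_left nhdsWithin_le_nhds
    have h1 := hlim.eventually_const_lt (show G (W / 2) / 2 < 0 by linarith)
    have h2 := hlim.eventually_const_lt (show -(k * y₀ * (W / 2)) < 0 by
      have : 0 < k * y₀ * (W / 2) := by positivity
      linarith)
    have h3 : ∀ᶠ η in 𝓝[>] (0 : ℝ), η < W / 2 :=
      nhdsWithin_le_nhds (Iio_mem_nhds (by linarith))
    filter_upwards [h1, h2, h3] with η a1 a2 a3 using ⟨a1, a2, a3⟩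
  obtain ⟨η, ⟨hη1, hη2, hη3⟩, hη0⟩ := (hev.and self_mem_nhdsWithin).exists
  have hη0 : 0 < η := hη0
  refine ⟨η, hη0, by linarith, fun b hb t ht hy hwη t' ht' hy' => ?_⟩
  by_contra! hlt
  have hwt := F.critical_pos H hb ht hy
  have hwt' := F.critical_pos H hb (ht.trans ht'.le) hy'
  obtain ⟨t'', ht'', -, hpos, hWlt⟩ := F.exists_next_critical H hk1 hb (Or.inl rfl) ht hy
    (by linarith) ht' hy'
  have hmono : StrictMonoOn (fun s => 1 * (w b s - W)) (Icc t t'') :=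
    F.strictMonoOn_of_sign (convex_Icc _ _) (fun s hs => ht.trans hs.1)
      (by rw [interior_Icc]; exact hpos)
  have hle : ∀ {r s}, r ∈ Icc t t'' → s ∈ Icc t t'' → r ≤ s → w b r ≤ w b s := by
    intro r s hr hs hrs
    linarith [hmono.monotoneOn hr hs hrs]
  obtain ⟨s₂, hs₂, hws₂⟩ : W ∈ w b '' Icc t t'' :=
    intermediate_value_Icc ht''.1.le (F.cont_w b).continuousOn ⟨by linarith, by linarith⟩
  obtain ⟨s₁, hs₁, hws₁⟩ : W / 2 ∈ w b '' Icc t s₂ :=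
    intermediate_value_Icc hs₂.1 (F.cont_w b).continuousOn ⟨by linarith, by linarith⟩
  have hE := F.energy_mono H hk b
  have hs₁t : t < s₁ := lt_of_le_of_ne hs₁.1 (by rintro rfl; linarith)
  have hs₂t : s₂ < t'' := lt_of_le_of_ne hs₂.2 (by rintro rfl; linarith)
  have hEt : G η ≤ energy G w y b t := by
    simp only [energy, hy]
    have := H.G_anti.antitoneOn ⟨hwt.le, by linarith⟩ ⟨hη0.le, by linarith⟩ hwη
    linarith
  have hEt' : energy G w y b t' ≤ 0 := by
    simp only [energy, hy']
    have := H.G_neg hwt' hlt.le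
    linarith
  have hy_lower : ∀ s ∈ Icc s₁ s₂, y₀ ≤ y b s := by
    intro s hs
    have h1 : energy G w y b t ≤ energy G w y b s :=
      hE (mem_Ici.2 ht) (mem_Ici.2 (by linarith [hs.1])) (by linarith [hs.1])
    have h2 : W / 2 ≤ w b s := by
      rw [← hws₁]
      exact hle ⟨hs₁.1, by linarith [hs₁.2]⟩ ⟨by linarith [hs.1], by linarith [hs.2]⟩ hs.1
    have h3 : w b s ≤ W := by
      rw [← hws₂]
      exact hle ⟨by linarith [hs.1], by linarith [hs.2]⟩ hs₂ hs.2
    have h4 := H.G_anti.antitoneOn (a := W / 2) ⟨by linarith, by linarith⟩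
      ⟨by linarith, h3⟩ h2
    have h5 : 0 < y b s := by
      simpa using hpos s ⟨by linarith [hs.1], by linarith [hs.2]⟩
    have h6 : y₀ ^ 2 ≤ y b s ^ 2 := by
      simp only [energy] at h1 hEt
      nlinarith
    exact (pow_le_pow_iff_left₀ hy₀p.le h5.le two_ne_zero).1 h6
  have hmon : MonotoneOn (fun s => energy G w y b s - k * y₀ * w b s) (Icc s₁ s₂) := by
    have hc : Continuous (energy G w y b) :=
      (F.continuous_energy H).comp (Continuous.prodMk_right b)
    have hd : ∀ s ∈ interior (Icc s₁ s₂), HasDerivAt (fun s => energy G w y b s - k * y₀ * w b s)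
        (k * (Real.cosh s / Real.sinh s) * y b s ^ 2 - k * y₀ * y b s) s := by
      intro s hs
      rw [interior_Icc] at hs
      have hs0 : 0 < s := by linarith [hs.1]
      exact (F.hasDerivAt_energy H b hs0).sub ((F.deriv_w b s hs0).const_mul _)
    refine monotoneOn_of_deriv_nonneg (convex_Icc _ _)
      (hc.sub (continuous_const.mul (F.cont_w b))).continuousOn
      (fun s hs => (hd s hs).differentiableAt.differentiableWithinAt) fun s hs => ?_
    rw [(hd s hs).deriv]
    rw [interior_Icc] at hs
    have hs0 : 0 < s := by linarith [hs.1]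
    have h1 := hy_lower s (Ioo_subset_Icc_self hs)
    have h2 : 1 ≤ Real.cosh s / Real.sinh s := by
      rw [one_le_div (Real.sinh_pos_iff.2 hs0)]
      exact (Real.sinh_lt_cosh s).le
    have h3 : 0 ≤ k * y b s * (y b s - y₀) :=
      mul_nonneg (mul_nonneg hk.le (hy₀p.le.trans h1)) (sub_nonneg.2 h1)
    have h4 : 0 ≤ k * y b s ^ 2 * (Real.cosh s / Real.sinh s - 1) :=
      mul_nonneg (by positivity) (sub_nonneg.2 h2)
    linarith
  have h1 := hmon ⟨le_rfl, hs₁.2⟩ ⟨hs₁.2, le_rfl⟩ hs₁.2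
  simp only [hws₁, hws₂] at h1
  have h2 : energy G w y b t ≤ energy G w y b s₁ :=
    hE (mem_Ici.2 ht) (mem_Ici.2 (by linarith)) hs₁t.le
  have h3 : energy G w y b s₂ ≤ energy G w y b t' :=
    hE (mem_Ici.2 (by linarith [hs₂.1])) (mem_Ici.2 (by linarith)) (by linarith [ht''.2])
  linarith

/-- Near `W` the trajectories oscillate around `W`. -/
lemma exists_sign_change (F : IsFlow k g w y) (H : IsWell g G W M) (hk : 0 < k) (hk1 : k < 1)
    (hb : b ∈ Ioo 0 W) {t₀ δ σ : ℝ} (hσ : σ = 1 ∨ σ = -1) (ht₀ : 1 ≤ t₀)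
    (hδ : ∀ v, |v| ≤ δ → v ^ 2 ≤ g (W + v) * v)
    (hv : ∀ t ∈ Icc t₀ (t₀ + 18), |w b t - W| ≤ δ) :
    ∃ t ∈ Icc t₀ (t₀ + 18), σ * (w b t - W) < 0 := by
  by_contra! hcon
  have hd : ∀ t, 0 < t → HasDerivAt (fun t => σ * (w b t - W)) (σ * y b t) t :=
    fun t ht => ((F.deriv_w b t ht).sub_const W).const_mul σ
  have hne : ∀ t ∈ Ioo t₀ (t₀ + 18), w b t - W ≠ 0 := by
    intro t ht h0
    have htp : 0 < t := by linarith [ht.1]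
    have hmin : IsLocalMin (fun t => σ * (w b t - W)) t := by
      filter_upwards [Ioo_mem_nhds ht.1 ht.2] with s hs
      rw [h0, mul_zero]
      exact hcon s (Ioo_subset_Icc_self hs)
    have h1 := hmin.hasDerivAt_eq_zero (hd t htp)
    have h2 : y b t = 0 := by rcases hσ with rfl | rfl <;> simpa using h1
    exact F.critical_ne H hb htp.le h2 (sub_eq_zero.1 h0)
  set φ : ℝ → ℝ := fun t => y b t / (w b t - W) with hφ
  have hθ : ∀ t ∈ Ioo t₀ (t₀ + 18), ∃ c ≤ -(1 / 4 : ℝ),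
      HasDerivAt (fun t => Real.arctan (φ t)) c t := by
    intro t ht
    have htp : 0 < t := by linarith [ht.1]
    have hvt := hne t ht
    have h1 := ((F.deriv_y b t htp).div ((F.deriv_w b t htp).sub_const W) hvt).arctan
    refine ⟨_, ?_, h1⟩
    have hs : 0 < Real.sinh t := Real.sinh_pos_iff.2 htp
    set h := k * (Real.cosh t / Real.sinh t) with hh
    have hh0 : 0 ≤ h := by have := Real.cosh_pos t; positivity
    have hh1 : h ≤ 3 / 2 := by
      have : Real.cosh t / Real.sinh t ≤ 3 / 2 := by
        rw [div_le_iff₀ hs, Real.cosh_eq, Real.sinh_eq]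
        have e1 : t + 1 ≤ Real.exp t := Real.add_one_le_exp t
        have e2 : Real.exp t * Real.exp (-t) = 1 := by rw [← Real.exp_add]; simp
        have e3 : Real.exp 1 ≤ Real.exp t := Real.exp_le_exp.2 (by linarith [ht.1])
        have e4 := Real.exp_one_gt_d9
        have e5 : 0 < Real.exp (-t) := Real.exp_pos _
        nlinarith
      have h0 : 0 ≤ Real.cosh t / Real.sinh t := by have := Real.cosh_pos t; positivity
      nlinarith
    have hG := hδ _ (hv t (Ioo_subset_Icc_self ht))
    rw [add_sub_cancel] at hG
    set v := w b t - W with hv'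
    have hv2 : 0 < v ^ 2 := by positivity
    have hGv : 1 ≤ g (w b t) / v := by
      have : g (w b t) / v = g (w b t) * v / v ^ 2 := by field_simp
      rw [this, le_div_iff₀ hv2]
      linarith
    have e : ((h * y b t - g (w b t)) * v - y b t * y b t) / v ^ 2 =
        h * φ t - g (w b t) / v - φ t ^ 2 := by
      simp only [hφ, ← hv']
      field_simp
    simp only [Pi.div_apply, ← hv'] at *
    rw [e, one_div_mul_eq_div, div_le_iff₀ (by positivity)]
    have e3 : φ t = y b t / v := rfl
    rw [← e3]
    nlinarith [sq_nonneg (φ t - 1), sq_nonneg (φ t), mul_nonneg hh0 (sq_nonneg (φ t - 1))]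
  have hanti : AntitoneOn (fun t => Real.arctan (φ t) + t / 4) (Icc (t₀ + 1) (t₀ + 17)) := by
    have hsub : Icc (t₀ + 1) (t₀ + 17) ⊆ Ioo t₀ (t₀ + 18) :=
      fun s hs => ⟨by linarith [hs.1], by linarith [hs.2]⟩
    have hdd : ∀ t ∈ Icc (t₀ + 1) (t₀ + 17), ∃ c ≤ (0 : ℝ),
        HasDerivAt (fun t => Real.arctan (φ t) + t / 4) c t := by
      intro t ht
      obtain ⟨c, hc, hcd⟩ := hθ t (hsub ht)
      exact ⟨c + 1 / 4, by linarith, hcd.add ((hasDerivAt_id t).div_const 4)⟩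
    refine antitoneOn_of_deriv_nonpos (convex_Icc _ _) (fun t ht => ?_) (fun t ht => ?_)
      fun t ht => ?_
    · obtain ⟨c, -, hcd⟩ := hdd t ht
      exact hcd.continuousAt.continuousWithinAt
    · obtain ⟨c, -, hcd⟩ := hdd t (interior_subset ht)
      exact hcd.differentiableAt.differentiableWithinAt
    · obtain ⟨c, hc, hcd⟩ := hdd t (interior_subset ht)
      rw [hcd.deriv]
      exact hc
  have h1 := hanti (a := t₀ + 1) ⟨le_rfl, by linarith⟩ (b := t₀ + 17)
    ⟨by linarith, le_rfl⟩ (by linarith)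
  simp only at h1
  have h2 := Real.arctan_lt_pi_div_two (φ (t₀ + 1))
  have h3 := Real.neg_pi_div_two_lt_arctan (φ (t₀ + 17))
  have h4 := Real.pi_lt_d2
  linarith

/-- `Chain w y W b j t` says that `t` is the last of `j + 1` critical times of the trajectory
starting at `b`, beginning with time `0`, at which `w` is alternately below and above `W`. -/
def Chain (w y : ℝ → ℝ → ℝ) (W b : ℝ) : ℕ → ℝ → Prop
  | 0, t => t = 0
  | j + 1, t => ∃ s, s ≤ t ∧ Chain w y W b j s ∧ y b t = 0 ∧ 0 ≤ (-1) ^ j * (w b t - W)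

lemma neg_one_pow_cases (j : ℕ) : (-1 : ℝ) ^ j = 1 ∨ (-1 : ℝ) ^ j = -1 :=
  neg_one_pow_eq_or ℝ j

lemma Chain.nonneg : ∀ {j : ℕ} {t : ℝ}, Chain w y W b j t → 0 ≤ t
  | 0, t, h => (show t = 0 from h).ge
  | _ + 1, _, ⟨_, hst, hs, _⟩ => hs.nonneg.trans hst

lemma Chain.spec (F : IsFlow k g w y) (H : IsWell g G W M) (hb : b ∈ Ioo 0 W) :
    ∀ {j : ℕ} {t : ℝ}, Chain w y W b j t →
      0 ≤ t ∧ y b t = 0 ∧ (-1) ^ j * (w b t - W) < 0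
  | 0, t, h => by
    have h : t = 0 := h
    subst h
    refine ⟨le_rfl, F.y_zero b, ?_⟩
    rw [F.w_zero]
    linarith [hb.2]
  | j + 1, t, ⟨s, hst, hs, hy, hle⟩ => by
    have h := Chain.spec F H hb hs
    have ht := h.1.trans hst
    refine ⟨ht, hy, ?_⟩
    have hne := sub_ne_zero.2 (F.critical_ne H hb ht hy)
    have h0 : (-1 : ℝ) ^ j * (w b t - W) ≠ 0 := mul_ne_zero (by simp) hne
    have : 0 < (-1 : ℝ) ^ j * (w b t - W) := lt_of_le_of_ne hle h0.symm
    rw [pow_succ]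
    linarith

lemma Chain.exists_lt (F : IsFlow k g w y) (H : IsWell g G W M) (hb : b ∈ Ioo 0 W) {j : ℕ} {t : ℝ}
    (h : Chain w y W b (j + 1) t) : ∃ s < t, Chain w y W b j s := by
  obtain ⟨s, hst, hs, hy, hle⟩ := h
  refine ⟨s, lt_of_le_of_ne hst ?_, hs⟩
  rintro rfl
  linarith [(hs.spec F H hb).2.2]

lemma isCompact_chain (F : IsFlow k g w y) (b₁ b₂ T : ℝ) :
    ∀ j : ℕ, IsCompact {p : ℝ × ℝ | p ∈ Icc b₁ b₂ ×ˢ Icc 0 T ∧ Chain w y W p.1 j p.2}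
  | 0 => by
    have : IsClosed {p : ℝ × ℝ | p.2 = 0} := isClosed_eq continuous_snd continuous_const
    exact (isCompact_Icc.prod isCompact_Icc).inter_right this
  | j + 1 => by
    have ih := isCompact_chain F b₁ b₂ T j
    have h1 := ih.prod (isCompact_Icc (a := (0 : ℝ)) (b := T))
    set e : (ℝ × ℝ) × ℝ → ℝ × ℝ := fun q => (q.1.1, q.2) with he
    have hec : Continuous e := by fun_prop
    have hw := F.continuous_w.comp hec
    have hy := F.continuous_y.comp hec
    have h2 : IsClosed ({q : (ℝ × ℝ) × ℝ | q.1.2 ≤ q.2} ∩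
        {q | Function.uncurry y (e q) = 0} ∩
        {q | 0 ≤ (-1) ^ j * (Function.uncurry w (e q) - W)}) :=
      ((isClosed_le (by fun_prop) (by fun_prop)).inter (isClosed_eq hy continuous_const)).inter
        (isClosed_le continuous_const (continuous_const.mul (hw.sub continuous_const)))
    convert (h1.inter_right h2).image hec using 1
    ext ⟨b, t⟩
    constructor
    · rintro ⟨⟨hb, ht⟩, s, hst, hs, hy, hle⟩
      exact ⟨((b, s), t), ⟨⟨⟨⟨hb, hs.nonneg, hst.trans ht.2⟩, hs⟩, ht⟩, ⟨hst, hy⟩, hle⟩, rfl⟩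
    · rintro ⟨⟨⟨b', s⟩, t'⟩, ⟨⟨⟨⟨hb, hs0⟩, hs⟩, ht⟩, ⟨hst, hy⟩, hle⟩, heq⟩
      obtain ⟨rfl, rfl⟩ := Prod.mk.inj heq
      exact ⟨⟨hb, ht⟩, s, hst, hs, hy, hle⟩

lemma isClosed_chain (F : IsFlow k g w y) (b₁ b₂ T : ℝ) (j : ℕ) :
    IsClosed {b | b ∈ Icc b₁ b₂ ∧ ∃ t ∈ Icc 0 T, Chain w y W b j t} := by
  convert ((F.isCompact_chain (W := W) b₁ b₂ T j).image continuous_fst).isClosed using 1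
  ext b
  constructor
  · rintro ⟨hb, t, ht, h⟩
    exact ⟨(b, t), ⟨⟨hb, ht⟩, h⟩, rfl⟩
  · rintro ⟨⟨b, t⟩, ⟨⟨hb, ht⟩, h⟩, rfl⟩
    exact ⟨hb, t, ht, h⟩

/-- A chain at `b` with end points to the right of `b` can be obtained as a limit. -/
lemma Chain.of_eventually (F : IsFlow k g w y) {T : ℝ} {j : ℕ}
    (h : ∀ᶠ b' in 𝓝[>] b, ∃ t ∈ Icc 0 T, Chain w y W b' j t) :
    ∃ t ∈ Icc 0 T, Chain w y W b j t := by
  have h2 : ∀ᶠ b' in 𝓝[>] b, b' ∈ {b' | b' ∈ Icc b (b + 1) ∧ ∃ t ∈ Icc 0 T, Chain w y W b' j t} := by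
    filter_upwards [h, Ioo_mem_nhdsGT (show b < b + 1 by linarith)] with b' h1 h2
      using ⟨Ioo_subset_Icc_self h2, h1⟩
  exact ((F.isClosed_chain b (b + 1) T j).mem_of_frequently_of_tendsto h2.frequently
    (tendsto_id'.2 nhdsWithin_le_nhds)).2

lemma Chain.eventually (F : IsFlow k g w y) (H : IsWell g G W M) (hb : b ∈ Ioo 0 W) :
    ∀ {j : ℕ} {t : ℝ}, Chain w y W b j t → ∀ ε > 0,
      ∀ᶠ b' in 𝓝 b, ∃ t', |t' - t| < ε ∧ Chain w y W b' j t'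
  | 0, t, h => fun ε hε => by
    have h : t = 0 := h
    subst h
    exact Eventually.of_forall fun b' => ⟨0, by simpa using hε, rfl⟩
  | j + 1, t, h => fun ε hε => by
    obtain ⟨s, hst, hs⟩ := h.exists_lt F H hb
    obtain ⟨-, hy, hlt⟩ := h.spec F H hb
    have hs0 := (hs.spec F H hb).1
    have ht : 0 < t := hs0.trans_lt hst
    have ih := hs.eventually F H hb ((t - s) / 2) (by linarith)
    have hg := H.sign_g (neg_one_pow_cases (j + 1)) (F.critical_pos H hb ht.le hy) hlt
    set σ : ℝ := (-1) ^ (j + 1) with hσ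
    have hσj : (-1 : ℝ) ^ j = -σ := by rw [hσ, pow_succ]; ring
    have hcw : ContinuousAt (fun p : ℝ × ℝ => σ * (w p.1 p.2 - W)) (b, t) :=
      (continuous_const.mul (F.continuous_w.sub continuous_const)).continuousAt
    have hev := hcw.eventually_lt_const hlt
    rw [nhds_prod_eq] at hev
    obtain ⟨P, hP, Q, hQ, hPQ⟩ := eventually_prod_iff.1 hev
    obtain ⟨r₀, hr₀, hr₀Q⟩ := Metric.eventually_nhds_iff.1 hQ
    set r := min (min r₀ ε) ((t - s) / 2) with hr
    have hrp : 0 < r := lt_min (lt_min hr₀ hε) (by linarith)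
    have hrr₀ : r ≤ r₀ := (min_le_left _ _).trans (min_le_left _ _)
    have hrε : r ≤ ε := (min_le_left _ _).trans (min_le_right _ _)
    have hrs : r ≤ (t - s) / 2 := min_le_right _ _
    have h1 := (F.deriv_y b t ht).const_mul σ
    rw [hy, mul_zero, zero_sub] at h1
    have h1 := hasDerivAt_iff_tendsto_slope.1 h1
    have hpos : 0 < σ * -g (w b t) := by linarith
    obtain ⟨tr, htr, htr1, htr2⟩ : ∃ x, 0 < σ * y b x ∧ t < x ∧ x < t + r := by
      have h2 := h1.mono_left (nhdsWithin_mono t (s := Ioi t) fun s (hs : t < s) => hs.ne')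
      obtain ⟨x, hx, hx1, hx2⟩ := ((h2.eventually_const_lt hpos).and
        (Ioo_mem_nhdsGT (show t < t + r by linarith))).exists
      rw [slope_def_field, hy, mul_zero, sub_zero] at hx
      exact ⟨x, (div_pos_iff_of_pos_right (sub_pos.2 hx1)).1 hx, hx1, hx2⟩
    obtain ⟨tl, htl, htl1, htl2⟩ : ∃ x, σ * y b x < 0 ∧ t - r < x ∧ x < t := by
      have h2 := h1.mono_left (nhdsWithin_mono t (s := Iio t) fun s (hs : s < t) => hs.ne)
      obtain ⟨x, hx, hx1, hx2⟩ := ((h2.eventually_const_lt hpos).and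
        (Ioo_mem_nhdsLT (show t - r < t by linarith))).exists
      rw [slope_def_field, hy, mul_zero, sub_zero] at hx
      refine ⟨x, ?_, hx1, hx2⟩
      by_contra! hcon
      have := div_nonpos_of_nonneg_of_nonpos hcon (sub_nonpos.2 hx2.le)
      linarith
    have hc : ∀ x, ContinuousAt (fun b' => σ * y b' x) b := fun x =>
      (continuous_const.mul (F.continuous_y.comp (Continuous.prodMk_left x))).continuousAt
    filter_upwards [ih, hP, (hc tr).eventually_const_lt htr, (hc tl).eventually_lt_const htl]
      with b' ⟨s', hs', hcs'⟩ hPb' hbr hbl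
    obtain ⟨x, hx, hx0⟩ : (0 : ℝ) ∈ (fun x => σ * y b' x) '' Icc tl tr :=
      intermediate_value_Icc (htl2.trans htr1).le
        (continuous_const.mul (F.cont_y b')).continuousOn ⟨hbl.le, hbr.le⟩
    have hxt : |x - t| < r := abs_lt.2 ⟨by linarith [hx.1], by linarith [hx.2]⟩
    have hyx : y b' x = 0 := by
      have : σ ≠ 0 := by simp [hσ]
      simpa [this] using hx0
    have hwx := hPQ hPb' (hr₀Q (show dist x t < r₀ by rw [Real.dist_eq]; linarith))
    simp only at hwx
    refine ⟨x, hxt.trans_le hrε, s', ?_, hcs', hyx, ?_⟩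
    · have := abs_lt.1 hxt
      have := abs_lt.1 hs'
      linarith
    · rw [hσj]; linarith

lemma exists_chain_of_near (F : IsFlow k g w y) (H : IsWell g G W M) (hk : 0 < k) (hk1 : k < 1)
    (hb : b ∈ Ioo 0 W) {δ : ℝ} (hδ : ∀ v, |v| ≤ δ → v ^ 2 ≤ g (W + v) * v) {n : ℕ}
    (hv : ∀ t ∈ Icc (0 : ℝ) (1 + 36 * n), |w b t - W| ≤ δ) :
    ∀ j ≤ n, ∃ t ≤ 1 + 36 * (j : ℝ), Chain w y W b j t := by
  intro j
  induction j with
  | zero => exact fun _ => ⟨0, by simp, rfl⟩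
  | succ j ih =>
    intro hj
    obtain ⟨t, ht, hc⟩ := ih (by omega)
    obtain ⟨ht0, hy, hlt⟩ := hc.spec F H hb
    have hjn : (j : ℝ) + 1 ≤ n := by exact_mod_cast hj
    set m := max t 1 with hm
    have hm1 : 1 ≤ m := le_max_right _ _
    have htm : t ≤ m := le_max_left _ _
    have hmj : m ≤ 1 + 36 * (j : ℝ) := max_le ht (by simp)
    have hσ := neg_one_pow_cases j
    set σ : ℝ := (-1) ^ j with hσdef
    have hσ' : -σ = 1 ∨ -σ = -1 := by rcases hσ with h | h <;> simp [h]
    obtain ⟨s₁, hs₁, hs₁w⟩ := F.exists_sign_change H hk hk1 hb hσ' hm1 hδ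
      fun t ht => hv t ⟨by linarith [ht.1], by linarith [ht.2]⟩
    obtain ⟨s₂, hs₂, hs₂w⟩ := F.exists_sign_change H hk hk1 hb hσ (t₀ := m + 18) (by linarith) hδ
      fun t ht => hv t ⟨by linarith [ht.1], by linarith [ht.2]⟩
    have hcont : Continuous fun t => σ * (w b t - W) :=
      continuous_const.mul ((F.cont_w b).sub continuous_const)
    obtain ⟨x, hx, hmax⟩ := isCompact_Icc.exists_isMaxOn (s := Icc t s₂)
      ⟨t, le_rfl, by linarith [hs₂.1]⟩ hcont.continuousOn
    have h1 : σ * (w b s₁ - W) ≤ σ * (w b x - W) :=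
      isMaxOn_iff.1 hmax s₁ ⟨by linarith [hs₁.1], by linarith [hs₁.2, hs₂.1]⟩
    have hxt : t < x := lt_of_le_of_ne hx.1 (by rintro rfl; linarith)
    have hxs : x < s₂ := lt_of_le_of_ne hx.2 (by rintro rfl; linarith)
    have hd := (hmax.isLocalMax (Icc_mem_nhds hxt hxs)).hasDerivAt_eq_zero
      (((F.deriv_w b x (ht0.trans_lt hxt)).sub_const W).const_mul σ)
    have hyx : y b x = 0 := by
      have : σ ≠ 0 := by simp [hσdef]
      simpa [this] using hd
    refine ⟨x, ?_, t, hxt.le, hc, hyx, by linarith⟩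
    push_cast
    linarith [hs₂.2]

lemma Chain.le_encard (F : IsFlow k g w y) (H : IsWell g G W M) (hb : b ∈ Ioo 0 W) :
    ∀ {j : ℕ} {t : ℝ}, Chain w y W b j t → (j : ℕ∞) ≤ {s ∈ Ioc 0 t | y b s = 0}.encard
  | 0, t, h => by simp
  | j + 1, t, h => by
    obtain ⟨s, hst, hs⟩ := h.exists_lt F H hb
    have hs0 := (hs.spec F H hb).1
    have ih := hs.le_encard F H hb
    have hy := (h.spec F H hb).2.1
    have hnot : t ∉ {x ∈ Ioc 0 s | y b x = 0} := fun hx => by linarith [hx.1.2]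
    calc ((j + 1 : ℕ) : ℕ∞) = j + 1 := by push_cast; rfl
      _ ≤ {x ∈ Ioc 0 s | y b x = 0}.encard + 1 := by gcongr
      _ = (insert t {x ∈ Ioc 0 s | y b x = 0}).encard := (encard_insert_of_notMem hnot).symm
      _ ≤ {x ∈ Ioc 0 t | y b x = 0}.encard := encard_le_encard <| insert_subset
        ⟨⟨hs0.trans_lt hst, le_rfl⟩, hy⟩ fun x hx => ⟨⟨hx.1.1, hx.1.2.trans hst.le⟩, hx.2⟩

/-- The `i`-th critical time after `0`, with the zeros of `w - W` before it counted. -/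
structure IsNthCritical (w y : ℝ → ℝ → ℝ) (W b : ℝ) (i : ℕ) (t : ℝ) : Prop where
  chain : Chain w y W b i t
  zeros : {s ∈ Ioo 0 t | w b s = W}.encard = i
  critical : {s ∈ Ioc 0 t | y b s = 0}.encard = i

lemma isNthCritical_zero (w y : ℝ → ℝ → ℝ) (W b : ℝ) : IsNthCritical w y W b 0 0 :=
  ⟨rfl, by simp, by simp⟩

lemma IsNthCritical.exists_succ (F : IsFlow k g w y) (H : IsWell g G W M) (hk1 : k < 1)
    (hb : b ∈ Ioo 0 W) {i : ℕ} {t t₁ : ℝ} (h : IsNthCritical w y W b i t) (ht₁ : t < t₁)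
    (hy₁ : y b t₁ = 0) : ∃ t', IsNthCritical w y W b (i + 1) t' := by
  obtain ⟨ht, hy, hlt⟩ := h.chain.spec F H hb
  have hσ := neg_one_pow_cases i
  obtain ⟨t', ht', hy', hpos, hgt⟩ := F.exists_next_critical H hk1 hb hσ ht hy hlt ht₁ hy₁
  have hne := F.critical_ne H hb ht hy
  have hmono := F.strictMonoOn_of_sign (W := W) (convex_Icc t t') (fun s hs => ht.trans hs.1)
      (by rw [interior_Icc]; exact hpos)
  set σ : ℝ := (-1) ^ i with hσdef
  have hσ0 : σ ≠ 0 := by simp [hσdef]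
  obtain ⟨z, hz, hz0⟩ : (0 : ℝ) ∈ (fun s => σ * (w b s - W)) '' Icc t t' :=
    intermediate_value_Icc ht'.1.le
      (continuous_const.mul ((F.cont_w b).sub continuous_const)).continuousOn ⟨hlt.le, hgt.le⟩
  have hzW : w b z = W := by simpa [hσ0, sub_eq_zero] using hz0
  have hzt : t < z := lt_of_le_of_ne hz.1 (by rintro rfl; exact hne hzW)
  have hzt' : z < t' := lt_of_le_of_ne hz.2 (by rintro rfl; rw [hzW] at hgt; simp at hgt)
  refine ⟨t', ⟨t, ht'.1.le, h.chain, hy', hgt.le⟩, ?_, ?_⟩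
  · have e : {s ∈ Ioo 0 t' | w b s = W} = insert z {s ∈ Ioo 0 t | w b s = W} := by
      ext s
      simp only [mem_ofPred_eq, mem_insert_iff, mem_Ioo]
      constructor
      · rintro ⟨⟨h1, h2⟩, h3⟩
        rcases lt_trichotomy s t with hs | rfl | hs
        · exact Or.inr ⟨⟨h1, hs⟩, h3⟩
        · exact absurd h3 hne
        · refine Or.inl (hmono.injOn ⟨hs.le, h2.le⟩ hz ?_)
          simp only [h3, hzW]
      · rintro (rfl | ⟨⟨h1, h2⟩, h3⟩)
        · exact ⟨⟨ht.trans_lt hzt, hzt'⟩, hzW⟩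
        · exact ⟨⟨h1, h2.trans ht'.1⟩, h3⟩
    rw [e, encard_insert_of_notMem (fun hx => by linarith [hx.1.2]), h.zeros]
    push_cast; rfl
  · have e : {s ∈ Ioc 0 t' | y b s = 0} = insert t' {s ∈ Ioc 0 t | y b s = 0} := by
      ext s
      simp only [mem_ofPred_eq, mem_insert_iff, mem_Ioc]
      constructor
      · rintro ⟨⟨h1, h2⟩, h3⟩
        rcases le_or_gt s t with hs | hs
        · exact Or.inr ⟨⟨h1, hs⟩, h3⟩
        · rcases h2.eq_or_lt with rfl | h2
          · exact Or.inl rfl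
          · have := hpos s ⟨hs, h2⟩
            simp [h3] at this
      · rintro (rfl | ⟨⟨h1, h2⟩, h3⟩)
        · exact ⟨⟨ht.trans_lt ht'.1, le_rfl⟩, hy'⟩
        · exact ⟨⟨h1, h2.trans ht'.1.le⟩, h3⟩
    rw [e, encard_insert_of_notMem (fun hx => by linarith [hx.1.2, ht'.1]), h.critical]
    push_cast; rfl

end IsFlow

lemma one_le_coth {t : ℝ} (ht : 0 < t) : 1 ≤ Real.cosh t / Real.sinh t := by
  rw [one_le_div (Real.sinh_pos_iff.2 ht)]
  exact (Real.sinh_lt_cosh t).le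

lemma coth_le_one_add_exp {t : ℝ} (ht : 1 ≤ t) :
    Real.cosh t / Real.sinh t ≤ 1 + Real.exp (-t) := by
  have h0 : t ≤ Real.sinh t := Real.self_le_sinh_iff.2 (by linarith)
  have h1 : Real.cosh t - Real.sinh t = Real.exp (-t) := Real.cosh_sub_sinh t
  have h2 := Real.exp_pos (-t)
  rw [div_le_iff₀ (by linarith)]
  nlinarith

lemma tendsto_coth_atTop : Tendsto (fun t => Real.cosh t / Real.sinh t) atTop (𝓝 1) := by
  have h : Tendsto (fun t : ℝ => 1 + Real.exp (-t)) atTop (𝓝 (1 + 0)) :=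
    (Real.tendsto_exp_neg_atTop_nhds_zero).const_add 1
  rw [add_zero] at h
  refine tendsto_of_tendsto_of_tendsto_of_le_of_le' tendsto_const_nhds h ?_ ?_
  · filter_upwards [eventually_gt_atTop 0] with t ht using one_le_coth ht
  · filter_upwards [eventually_ge_atTop 1] with t ht using coth_le_one_add_exp ht

/-- If a convergent function has a convergent derivative then the latter tends to zero. -/
lemma eq_zero_of_tendsto_deriv {f f' : ℝ → ℝ} {l c T : ℝ}
    (hd : ∀ t, T < t → HasDerivAt f (f' t) t) (hf : Tendsto f atTop (𝓝 l))
    (hf' : Tendsto f' atTop (𝓝 c)) : c = 0 := by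
  have h : ∀ t, T < t → ∃ ξ > t, f' ξ = f (t + 1) - f t := by
    intro t ht
    obtain ⟨ξ, hξ, he⟩ := exists_hasDerivAt_eq_slope f f' (show t < t + 1 by linarith)
      (fun s hs => (hd s (ht.trans_le hs.1)).continuousAt.continuousWithinAt)
      (fun s hs => hd s (ht.trans hs.1))
    exact ⟨ξ, hξ.1, by rw [he]; ring⟩
  choose! ξ hξ he using h
  have h1 : Tendsto ξ atTop atTop := by
    refine tendsto_atTop_mono' _ ?_ tendsto_id
    filter_upwards [eventually_gt_atTop T] with t ht using (hξ t ht).le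
  have h2 : Tendsto (fun t => f (t + 1) - f t) atTop (𝓝 (l - l)) :=
    (hf.comp (tendsto_atTop_add_const_right _ 1 tendsto_id)).sub hf
  rw [sub_self] at h2
  refine tendsto_nhds_unique (hf'.comp h1) (h2.congr' ?_)
  filter_upwards [eventually_gt_atTop T] with t ht using (he t ht).symm

namespace IsFlow

variable {k : ℝ} {g G : ℝ → ℝ} {w y : ℝ → ℝ → ℝ} {W M b : ℝ}

lemma sign_of_no_critical (F : IsFlow k g w y) (H : IsWell g G W M) (hk1 : k < 1)
    (hb : b ∈ Ioo 0 W) {t σ : ℝ} (hσ : σ = 1 ∨ σ = -1) (ht : 0 ≤ t) (hy : y b t = 0)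
    (hw : σ * (w b t - W) < 0) (hno : ∀ s > t, y b s ≠ 0) : ∀ s > t, 0 < σ * y b s := by
  intro s hs
  by_contra! hle
  obtain ⟨r, hr, hr1, hr2⟩ := ((F.eventually_sign H hk1 hb hσ ht hy hw).and
    (Ioo_mem_nhdsGT hs)).exists
  obtain ⟨z, hz, hz0⟩ : (0 : ℝ) ∈ (fun x => σ * y b x) '' Icc r s :=
    intermediate_value_Icc' hr2.le (continuous_const.mul (F.cont_y b)).continuousOn ⟨hle, hr.le⟩
  refine hno z (hr1.trans_le hz.1) ?_
  rcases hσ with rfl | rfl <;> simpa using hz0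

/-- A bounded trajectory of nonpositive energy which is eventually monotone tends to `0`. -/
lemma tendsto_zero_of_monotone_tail (F : IsFlow k g w y) (H : IsWell g G W M) (hk : 0 < k)
    (hb : b ∈ Ioo 0 W) (hE : ∀ t, 0 ≤ t → energy G w y b t ≤ 0) {t σ : ℝ} (hσ : σ = 1 ∨ σ = -1)
    (ht : 0 ≤ t) (hpos : ∀ s > t, 0 < σ * y b s) :
    σ = -1 ∧ Tendsto (w b) atTop (𝓝 0) := by
  have hw0 : ∀ s, 0 ≤ s → 0 < w b s := fun s hs => F.pos_of_energy_nonpos H hk hb hs (hE s hs)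
  have hwM : ∀ s, 0 ≤ s → w b s < M := fun s hs => lt_of_energy_nonpos H (hE s hs)
  have hmono : StrictMonoOn (fun s => σ * (w b s - 0)) (Ici t) :=
    F.strictMonoOn_of_sign (convex_Ici t) (fun s hs => ht.trans hs)
      (by rw [interior_Ici]; exact hpos)
  have hMpos : 0 < M := (hw0 0 le_rfl).trans (hwM 0 le_rfl)
  obtain ⟨l₀, hl₀⟩ : ∃ l, Tendsto (fun s => σ * (w b (max s t) - 0)) atTop (𝓝 l) := by
    refine ⟨_, tendsto_atTop_ciSup (fun r s hrs => hmono.monotoneOn (le_max_right r t)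
      (le_max_right s t) (max_le_max_right t hrs)) ⟨M, ?_⟩⟩
    rintro _ ⟨s, rfl⟩
    have h0 : 0 ≤ max s t := ht.trans (le_max_right _ _)
    have h1 := hw0 _ h0
    have h2 := hwM _ h0
    rcases hσ with rfl | rfl
    · simp only; linarith
    · simp only; linarith
  have hσσ : σ * σ = 1 := by rcases hσ with rfl | rfl <;> norm_num
  obtain ⟨l, hl⟩ : ∃ l, Tendsto (w b) atTop (𝓝 l) := by
    refine ⟨σ * l₀, (hl₀.const_mul σ).congr' ?_⟩
    filter_upwards [eventually_ge_atTop t] with s hs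
    rw [max_eq_left hs, ← mul_assoc, hσσ]; ring
  have hl0 : 0 ≤ l := ge_of_tendsto hl (by
    filter_upwards [eventually_ge_atTop 0] with s hs using (hw0 s hs).le)
  obtain ⟨e, he⟩ : ∃ e, Tendsto (energy G w y b) atTop (𝓝 e) := by
    have : ∃ e, Tendsto (fun s => energy G w y b (max s 0)) atTop (𝓝 e) := by
      refine ⟨_, tendsto_atTop_ciSup (fun r s hrs => F.energy_mono H hk b
        (mem_Ici.2 (le_max_right r 0)) (mem_Ici.2 (le_max_right s 0))
        (max_le_max_right 0 hrs)) ⟨0, ?_⟩⟩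
      rintro _ ⟨s, rfl⟩
      exact hE _ (le_max_right _ _)
    obtain ⟨e, he⟩ := this
    refine ⟨e, he.congr' ?_⟩
    filter_upwards [eventually_ge_atTop 0] with s hs
    rw [max_eq_left hs]
  have hG : Tendsto (fun s => G (w b s)) atTop (𝓝 (G l)) := (H.continuous_G.tendsto l).comp hl
  have hy2 : Tendsto (fun s => σ * y b s) atTop (𝓝 √(2 * (e - G l))) := by
    refine (((he.sub hG).const_mul 2).sqrt).congr' ?_
    filter_upwards [eventually_gt_atTop t] with s hs
    have h1 : 2 * (energy G w y b s - G (w b s)) = (σ * y b s) ^ 2 := by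
      rw [mul_pow, pow_two σ, hσσ]
      simp only [energy]; ring
    rw [h1, Real.sqrt_sq (hpos s hs).le]
  have hy3 : Tendsto (y b) atTop (𝓝 (σ * √(2 * (e - G l)))) := by
    refine (hy2.const_mul σ).congr fun s => ?_
    rw [← mul_assoc, hσσ, one_mul]
  have hy0 := eq_zero_of_tendsto_deriv (F.deriv_w b) hl hy3
  rw [hy0] at hy3
  have hgl : g l = 0 := by
    have h1 : Tendsto (fun t => k * (Real.cosh t / Real.sinh t) * y b t - g (w b t)) atTop
        (𝓝 (k * 1 * 0 - g l)) :=
      ((tendsto_coth_atTop.const_mul k).mul hy3).sub ((H.continuous_g.tendsto l).comp hl)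
    have := eq_zero_of_tendsto_deriv (F.deriv_y b) hy3 h1
    linarith
  have hlW : l ≠ W := by
    rintro rfl
    have h1 : Tendsto (energy G w y b) atTop (𝓝 (0 ^ 2 / 2 + G l)) :=
      ((hy3.pow 2).div_const 2).add hG
    have h2 : energy G w y b 0 ≤ 0 ^ 2 / 2 + G l := by
      refine ge_of_tendsto h1 ?_
      filter_upwards [eventually_ge_atTop 0] with s hs
      exact F.energy_mono H hk b self_mem_Ici (mem_Ici.2 hs) hs
    have h3 := H.G_anti ⟨hb.1.le, hb.2.le⟩ ⟨H.W_pos.le, le_rfl⟩ hb.2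
    simp only [energy, F.y_zero, F.w_zero] at h2
    linarith
  have hl00 : l = 0 := by
    by_contra hne
    have hlp : 0 < l := lt_of_le_of_ne hl0 (Ne.symm hne)
    rcases lt_or_gt_of_ne hlW with h | h
    · exact (H.g_neg l hlp h).ne hgl
    · exact (H.g_pos l h).ne' hgl
  rw [hl00] at hl
  refine ⟨?_, hl⟩
  rcases hσ with rfl | rfl
  · exfalso
    have h1 : w b t ≤ 0 := ge_of_tendsto hl (by
      filter_upwards [eventually_ge_atTop t] with s hs
      have := hmono.monotoneOn self_mem_Ici (mem_Ici.2 hs) hs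
      linarith)
    linarith [hw0 t ht]
  · rfl

lemma IsNthCritical.of_last (F : IsFlow k g w y) (H : IsWell g G W M) (hk : 0 < k) (hk1 : k < 1)
    (hb : b ∈ Ioo 0 W) (hE : ∀ t, 0 ≤ t → energy G w y b t ≤ 0) {i : ℕ} {t : ℝ}
    (h : IsNthCritical w y W b i t) (hno : ∀ s > t, y b s ≠ 0) :
    Odd i ∧ Tendsto (w b) atTop (𝓝 0) ∧ (∀ s > t, y b s < 0) ∧
      {s | 0 < s ∧ w b s = W}.encard = (i + 1 : ℕ) ∧ {s | 0 < s ∧ y b s = 0}.encard = i := by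
  obtain ⟨ht, hy, hlt⟩ := h.chain.spec F H hb
  have hpos := F.sign_of_no_critical H hk1 hb (neg_one_pow_cases i) ht hy hlt hno
  obtain ⟨hσ, hlim⟩ := F.tendsto_zero_of_monotone_tail H hk hb hE (neg_one_pow_cases i) ht hpos
  have hodd : Odd i := by
    by_contra hcon
    rw [Nat.not_odd_iff_even] at hcon
    rw [hcon.neg_one_pow] at hσ
    norm_num at hσ
  rw [hσ] at hpos hlt
  have hwt : W < w b t := by linarith
  have hmono : StrictMonoOn (fun s => -1 * (w b s - W)) (Ici t) :=
    F.strictMonoOn_of_sign (convex_Ici t) (fun s hs => ht.trans hs)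
      (by rw [interior_Ici]; exact hpos)
  refine ⟨hodd, hlim, fun s hs => by linarith [hpos s hs], ?_, ?_⟩
  · obtain ⟨r, hr, hrt⟩ := ((hlim.eventually_lt_const H.W_pos).and
      (eventually_ge_atTop t)).exists
    obtain ⟨z, hz, hzW⟩ : W ∈ w b '' Icc t r :=
      intermediate_value_Icc' hrt (F.cont_w b).continuousOn ⟨hr.le, hwt.le⟩
    have hzt : t < z := lt_of_le_of_ne hz.1 (by rintro rfl; linarith)
    have e : {s | 0 < s ∧ w b s = W} = insert z {s ∈ Ioo 0 t | w b s = W} := by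
      ext s
      simp only [mem_ofPred_eq, mem_insert_iff, mem_Ioo]
      constructor
      · rintro ⟨h1, h3⟩
        rcases lt_trichotomy s t with hs | rfl | hs
        · exact Or.inr ⟨⟨h1, hs⟩, h3⟩
        · linarith
        · refine Or.inl (hmono.injOn (mem_Ici.2 hs.le) (mem_Ici.2 hz.1) ?_)
          simp only [h3, hzW]
      · rintro (rfl | ⟨⟨h1, h2⟩, h3⟩)
        · exact ⟨ht.trans_lt hzt, hzW⟩
        · exact ⟨h1, h3⟩
    rw [e, encard_insert_of_notMem (fun hx => by linarith [hx.1.2]), h.zeros]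
    push_cast; rfl
  · rw [← h.critical]
    congr 1
    ext s
    constructor
    · rintro ⟨h1, h2⟩
      refine ⟨⟨h1, ?_⟩, h2⟩
      by_contra! hcon
      exact hno s hcon h2
    · rintro ⟨⟨h1, -⟩, h2⟩
      exact ⟨h1, h2⟩

lemma exists_last_critical (F : IsFlow k g w y) (H : IsWell g G W M) (hk1 : k < 1)
    (hb : b ∈ Ioo 0 W) {m : ℕ} (hm : ∀ t, ¬ Chain w y W b m t) :
    ∃ i < m, ∃ t, IsNthCritical w y W b i t ∧ ∀ s > t, y b s ≠ 0 := by
  by_contra! hcon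
  have : ∀ i ≤ m, ∃ t, IsNthCritical w y W b i t := by
    intro i
    induction i with
    | zero => exact fun _ => ⟨0, isNthCritical_zero w y W b⟩
    | succ i ih =>
      intro hi
      obtain ⟨t, ht⟩ := ih (by omega)
      obtain ⟨s, hs, hys⟩ := hcon i (by omega) t ht
      exact ht.exists_succ F H hk1 hb hs hys
  obtain ⟨t, ht⟩ := this m le_rfl
  exact hm t ht.chain

/-- There is a threshold below which the trajectories fail to have a chain of length `2 n`. -/
lemma exists_threshold (F : IsFlow k g w y) (H : IsWell g G W M) (hk : 0 < k) (hk1 : k < 1)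
    {n : ℕ} (hn : 1 ≤ n) : ∃ b ∈ Ioo 0 W, (∀ t, ¬ Chain w y W b (2 * n) t) ∧
      ∀ b' ∈ Ioo b W, ∃ t, Chain w y W b' (2 * n) t := by
  obtain ⟨η, hη, hηW, hret⟩ := F.exists_no_return H hk hk1
  set S : Set ℝ := {b | b ∈ Ioo 0 W ∧ ∀ t, ¬ Chain w y W b (2 * n) t} with hS
  have hηS : η ∈ S := by
    refine ⟨⟨hη, hηW⟩, fun t ht => ?_⟩
    have hb : η ∈ Ioo 0 W := ⟨hη, hηW⟩
    obtain ⟨h1, h2, h3⟩ := ht.spec F H hb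
    rw [Even.neg_one_pow ⟨n, by ring⟩] at h3
    obtain ⟨m, hm⟩ : ∃ m, 2 * n = m + 1 := ⟨2 * n - 1, by omega⟩
    rw [hm] at ht
    obtain ⟨s, hs, hcs⟩ := ht.exists_lt F H hb
    have := hret η hb 0 le_rfl (F.y_zero _) (F.w_zero _).le t (hcs.nonneg.trans_lt hs) h2
    linarith
  obtain ⟨c, hcW, hc⟩ : ∃ c < W, ∀ b ∈ Ioo c W, 0 < b → ∃ t, Chain w y W b (2 * n) t := by
    obtain ⟨δ, hδ, hδ'⟩ := H.near
    set T : ℝ := 1 + 36 * (2 * n : ℕ) with hT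
    have hev : ∀ᶠ b in 𝓝 W, ∀ t ∈ Icc 0 T, |w b t - W| < δ := by
      refine isCompact_Icc.eventually_forall_of_forall_eventually fun t ht => ?_
      have hc : ContinuousAt (fun p : ℝ × ℝ => |w p.1 p.2 - W|) (W, t) :=
        (F.continuous_w.sub continuous_const).abs.continuousAt
      refine hc.eventually_lt_const ?_
      simp [F.const W H.g_W t ht.1, hδ]
    obtain ⟨ε, hε, hεb⟩ := Metric.eventually_nhds_iff.1 hev
    refine ⟨W - ε, by linarith, fun b hb hb0 => ?_⟩
    have h1 := @hεb b (by rw [Real.dist_eq, abs_lt]; constructor <;> linarith [hb.1, hb.2])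
    obtain ⟨t, -, ht⟩ := F.exists_chain_of_near H hk hk1 ⟨hb0, hb.2⟩ hδ' (n := 2 * n)
      (fun t ht => (h1 t ht).le) (2 * n) le_rfl
    exact ⟨t, ht⟩
  have hSc : ∀ b ∈ S, b ≤ c := by
    intro b hb
    by_contra! hcb
    obtain ⟨t, ht⟩ := hc b ⟨hcb, hb.1.2⟩ hb.1.1
    exact hb.2 t ht
  have hbdd : BddAbove S := ⟨c, hSc⟩
  have hlub := isLUB_csSup ⟨η, hηS⟩ hbdd
  have h0 : 0 < sSup S := hη.trans_le (hlub.1 hηS)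
  have h1 : sSup S < W := (hlub.2 hSc).trans_lt hcW
  refine ⟨sSup S, ⟨h0, h1⟩, fun t ht => ?_, fun b' hb' => ?_⟩
  · have hev := ht.eventually F H ⟨h0, h1⟩ 1 one_pos
    obtain ⟨ε, hε, hεb⟩ := Metric.eventually_nhds_iff.1 hev
    obtain ⟨b, hbS, hb⟩ := exists_lt_of_lt_csSup ⟨η, hηS⟩ (show sSup S - ε < sSup S by linarith)
    have hb2 := hlub.1 hbS
    obtain ⟨t', -, ht'⟩ := @hεb b (by rw [Real.dist_eq, abs_lt]; constructor <;> linarith)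
    exact hbS.2 t' ht'
  · by_contra! hcon
    have : b' ≤ sSup S := hlub.1 ⟨⟨h0.trans hb'.1, hb'.2⟩, hcon⟩
    linarith [hb'.1]

theorem exists_connection (F : IsFlow k g w y) (H : IsWell g G W M) (hk : 0 < k) (hk1 : k < 1)
    {n : ℕ} (hn : 1 ≤ n) : ∃ b ∈ Ioo 0 W, (∀ t, 0 ≤ t → energy G w y b t ≤ 0) ∧
      Tendsto (w b) atTop (𝓝 0) ∧ (∀ᶠ t in atTop, y b t < 0) ∧
      {t | 0 < t ∧ w b t = W}.encard = (2 * n : ℕ) := by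
  obtain ⟨b, hb, hno, hgood⟩ := F.exists_threshold H hk hk1 hn
  have hgood' : ∀ᶠ b' in 𝓝[>] b, b' ∈ Ioo 0 W ∧ ∃ t, Chain w y W b' (2 * n) t := by
    filter_upwards [Ioo_mem_nhdsGT hb.2] with b' hb'
    exact ⟨⟨hb.1.trans hb'.1, hb'.2⟩, hgood b' hb'⟩
  have hE : ∀ t, 0 ≤ t → energy G w y b t ≤ 0 := by
    intro T hT
    by_contra! hpos
    have hc : ContinuousAt (fun b' => energy G w y b' T) b :=
      ((F.continuous_energy H).comp (Continuous.prodMk_left T)).continuousAt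
    have hev := (hc.eventually_const_lt hpos).filter_mono (nhdsWithin_le_nhds (s := Ioi b))
    obtain ⟨t, -, ht⟩ := Chain.of_eventually F (T := T) (W := W) (b := b) (j := 2 * n) (by
      filter_upwards [hgood', hev] with b' ⟨hb', t, ht⟩ hEb'
      obtain ⟨h1, h2, h3⟩ := ht.spec F H hb'
      rw [Even.neg_one_pow ⟨n, by ring⟩] at h3
      refine ⟨t, ⟨h1, ?_⟩, ht⟩
      by_contra! hTt
      have h4 := F.energy_mono H hk b' (mem_Ici.2 hT) (mem_Ici.2 h1) hTt.le
      have h5 := H.G_neg (F.critical_pos H hb' h1 h2) (by linarith)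
      simp only [energy, h2] at h4 hEb'
      linarith)
    exact hno t ht
  obtain ⟨i, hi, t, ht, hlast⟩ := F.exists_last_critical H hk1 hb hno
  obtain ⟨hodd, hlim, hneg, hzeros, hcrit⟩ := ht.of_last F H hk hk1 hb hE hlast
  refine ⟨b, hb, hE, hlim, ?_, ?_⟩
  · filter_upwards [eventually_gt_atTop t] with s hs using hneg s hs
  obtain ⟨m, hm⟩ : ∃ m, 2 * n = m + 2 := ⟨2 * n - 2, by omega⟩
  obtain ⟨η, hη, hηW, hret⟩ := F.exists_no_return H hk hk1
  obtain ⟨T, hTη, hTt⟩ := ((hlim.eventually_lt_const hη).and (eventually_gt_atTop t)).exists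
  have hT0 : 0 < T := ht.chain.nonneg.trans_lt hTt
  have hcw : ContinuousAt (fun b' => w b' T) b :=
    (F.continuous_w.comp (Continuous.prodMk_left T)).continuousAt
  have hcy : ContinuousAt (fun b' => y b' T) b :=
    (F.continuous_y.comp (Continuous.prodMk_left T)).continuousAt
  have hev1 := (hcw.eventually_lt_const hTη).filter_mono (nhdsWithin_le_nhds (s := Ioi b))
  have hev2 := (hcy.eventually_lt_const (hneg T hTt)).filter_mono (nhdsWithin_le_nhds (s := Ioi b))
  obtain ⟨s, -, hs⟩ := Chain.of_eventually F (T := T) (W := W) (b := b) (j := m) (by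
    filter_upwards [hgood', hev1, hev2] with b' ⟨hb', r, hr⟩ hw hy
    obtain ⟨h1, h2, h3⟩ := hr.spec F H hb'
    rw [Even.neg_one_pow ⟨n, by ring⟩] at h3
    rw [hm] at hr
    obtain ⟨r₁, hr₁, hcr₁⟩ := hr.exists_lt F H hb'
    obtain ⟨s, hs, hcs⟩ := hcr₁.exists_lt F H hb'
    obtain ⟨a1, a2, -⟩ := hcs.spec F H hb'
    refine ⟨s, ⟨a1, ?_⟩, hcs⟩
    by_contra! hTs
    have hws : η < w b' s := by
      by_contra! hcon
      linarith [hret b' hb' s a1 a2 hcon r (hs.trans hr₁) h2]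
    obtain ⟨x, hx, hmin⟩ := isCompact_Icc.exists_isMinOn (s := Icc T s) ⟨T, le_rfl, hTs.le⟩
      (F.cont_w b').continuousOn
    have hxT : w b' x ≤ w b' T := isMinOn_iff.1 hmin T ⟨le_rfl, hTs.le⟩
    have hxs : x < s := lt_of_le_of_ne hx.2 (by rintro rfl; linarith)
    have hTx : T < x := by
      refine lt_of_le_of_ne hx.1 ?_
      rintro rfl
      have hslope := (hasDerivAt_iff_tendsto_slope.1 (F.deriv_w b' T hT0)).mono_left
        (nhdsWithin_mono T (s := Ioi T) fun z (hz : T < z) => hz.ne')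
      obtain ⟨z, hz, hz1, hz2⟩ := ((hslope.eventually_lt_const hy).and
        (Ioo_mem_nhdsGT hTs)).exists
      have := isMinOn_iff.1 hmin z ⟨hz1.le, hz2.le⟩
      rw [slope_def_field] at hz
      have := div_nonneg (sub_nonneg.2 this) (sub_nonneg.2 hz1.le)
      linarith
    have hyx := (hmin.isLocalMin (Icc_mem_nhds hTx hxs)).hasDerivAt_eq_zero
      (F.deriv_w b' x (hT0.trans hTx))
    linarith [hret b' hb' x (hT0.trans hTx).le hyx (by linarith) r (by linarith) h2])
  have hle : (m : ℕ∞) ≤ i := by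
    rw [← hcrit]
    refine (hs.le_encard F H hb).trans (encard_le_encard fun z hz => ⟨hz.1.1, hz.2⟩)
  have hle' : m ≤ i := by exact_mod_cast hle
  rw [hzeros]
  congr 1
  obtain ⟨q, hq⟩ := hodd
  omega

end IsFlow

/-- The nonlinearity `x ^ p - a x`, extended to be constant outside `[0, M]`. -/
noncomputable def cutoff (p a M x : ℝ) : ℝ := max 0 (min x M) ^ p - a * max 0 (min x M)

lemma cutoff_of_mem {p a M x : ℝ} (hx : x ∈ Icc 0 M) : cutoff p a M x = x ^ p - a * x := by
  rw [cutoff, min_eq_left hx.2, max_eq_right hx.1]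

lemma hasDerivAt_rpow_sub {p : ℝ} (hp : 1 < p) (a x : ℝ) :
    HasDerivAt (fun x : ℝ => x ^ p - a * x) (p * x ^ (p - 1) - a) x := by
  have h := (Real.hasDerivAt_rpow_const (x := x) (Or.inr hp.le)).sub ((hasDerivAt_id x).const_mul a)
  convert! h using 1
  simp

lemma lipschitz_cutoff {p M : ℝ} (hp : 1 < p) (a : ℝ) (hM : 0 < M) :
    ∃ K, LipschitzWith K (cutoff p a M) := by
  have hc : Continuous fun x : ℝ => p * x ^ (p - 1) - a :=
    (continuous_const.mul (continuous_id.rpow_const fun x => Or.inr (by linarith))).sub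
      continuous_const
  obtain ⟨C, hC⟩ := isCompact_Icc.exists_bound_of_continuousOn (hc.continuousOn (s := Icc 0 M))
  have h1 : LipschitzOnWith (Real.toNNReal C) (fun x : ℝ => x ^ p - a * x) (Icc 0 M) :=
    (convex_Icc 0 M).lipschitzOnWith_of_nnnorm_hasDerivWithin_le
      (fun x _ => (hasDerivAt_rpow_sub hp a x).hasDerivWithinAt) fun x hx =>
        NNReal.coe_le_coe.1 ((hC x hx).trans (Real.le_coe_toNNReal C))
  have h2 : LipschitzWith 1 fun x : ℝ => max 0 (min x M) :=
    (LipschitzWith.id.min_const M).const_max 0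
  exact ⟨_, lipschitzOnWith_univ.1 (h1.comp h2.lipschitzOnWith
    fun x _ => ⟨le_max_left _ _, max_le hM.le (min_le_right _ _)⟩)⟩

lemma rpow_eq_mul {p x : ℝ} (hp : 1 < p) (hx : 0 ≤ x) : x ^ p = x * x ^ (p - 1) := by
  rcases hx.eq_or_lt with rfl | hx
  · rw [Real.zero_rpow (by linarith), zero_mul]
  · rw [Real.rpow_sub_one hx.ne']; field_simp

noncomputable def cutoffPrimitive (p a M x : ℝ) : ℝ := ∫ t in (0 : ℝ)..x, cutoff p a M t

section

variable {p a W M : ℝ}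

lemma hasDerivAt_cutoffPrimitive (hp : 1 < p) (hM : 0 < M) (x : ℝ) :
    HasDerivAt (cutoffPrimitive p a M) (cutoff p a M x) x := by
  obtain ⟨K, hK⟩ := lipschitz_cutoff hp a hM
  exact hK.continuous.integral_hasStrictDerivAt 0 x |>.hasDerivAt

lemma cutoffPrimitive_of_mem (hp : 1 < p) (hM : 0 < M) {x : ℝ} (hx : x ∈ Icc 0 M) :
    cutoffPrimitive p a M x = x ^ (p + 1) / (p + 1) - a * x ^ 2 / 2 := by
  obtain ⟨K, hK⟩ := lipschitz_cutoff hp a hM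
  have h : ∀ y ∈ uIcc 0 x, HasDerivAt (fun x : ℝ => x ^ (p + 1) / (p + 1) - a * x ^ 2 / 2)
      (cutoff p a M y) y := by
    intro y hy
    rw [uIcc_of_le hx.1] at hy
    rw [cutoff_of_mem ⟨hy.1, hy.2.trans hx.2⟩]
    have h1 := (Real.hasDerivAt_rpow_const (x := y) (p := p + 1) (Or.inr (by linarith))).div_const
      (p + 1)
    have h2 := (((hasDerivAt_id y).pow 2).const_mul a).div_const 2
    have hp1 : p + 1 ≠ 0 := by linarith
    convert! h1.sub h2 using 1
    simp only [id, add_sub_cancel_right]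
    field_simp
    ring
  have h0 : (0 : ℝ) ^ (p + 1) = 0 := Real.zero_rpow (by linarith)
  rw [cutoffPrimitive, intervalIntegral.integral_eq_sub_of_hasDerivAt h
    (hK.continuous.intervalIntegrable _ _), h0]
  ring

theorem isWell_cutoff (hp : 1 < p) (hW : 0 < W) (hWa : W ^ (p - 1) = a) (ha : 1 < (p - 1) * a)
    (hM : 0 < M) (hMa : M ^ (p - 1) = a * (p + 1)) :
    IsWell (cutoff p a M) (cutoffPrimitive p a M) W M := by
  have ha0 : 0 < a := hWa ▸ Real.rpow_pos_of_pos hW _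
  have hp1 : 0 < p - 1 := by linarith
  have hWM : W < M := by
    rw [← Real.rpow_lt_rpow_iff hW.le hM.le hp1, hWa, hMa]
    nlinarith
  have hpos : ∀ x, W < x → 0 < cutoff p a M x := by
    intro x hx
    have h1 : W < max 0 (min x M) := lt_max_of_lt_right (lt_min hx hWM)
    have h2 : a < max 0 (min x M) ^ (p - 1) := by
      rw [← hWa]
      exact Real.rpow_lt_rpow hW.le h1 hp1
    rw [cutoff, rpow_eq_mul hp (le_max_left _ _)]
    nlinarith
  refine ⟨hW, lipschitz_cutoff hp a hM, hasDerivAt_cutoffPrimitive hp hM, by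
    simp [cutoffPrimitive], fun x hx => ?_, fun x hx hxW => ?_, hpos, fun x hx => ?_, ?_⟩
  · rw [cutoff, min_eq_left (hx.trans hM.le), max_eq_left hx, Real.zero_rpow (by linarith)]
    ring
  · rw [cutoff_of_mem ⟨hx.le, (hxW.trans hWM).le⟩, rpow_eq_mul hp hx.le]
    have : x ^ (p - 1) < a := by
      rw [← hWa]
      exact Real.rpow_lt_rpow hx.le hxW hp1
    nlinarith
  · have h1 : 0 < cutoffPrimitive p a M M := by
      rw [cutoffPrimitive_of_mem hp hM ⟨hM.le, le_rfl⟩,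
        show M ^ (p + 1) = M ^ 2 * M ^ (p - 1) by
          rw [← Real.rpow_natCast, ← Real.rpow_add hM]; congr 1; push_cast; ring, hMa]
      have : M ^ 2 * (a * (p + 1)) / (p + 1) = M ^ 2 * a := by
        have hp1 : p + 1 ≠ 0 := by linarith
        field_simp
      rw [this]
      have : 0 < M ^ 2 * a := by positivity
      linarith
    have hmono : MonotoneOn (cutoffPrimitive p a M) (Ici M) := by
      refine monotoneOn_of_deriv_nonneg (convex_Ici M)
        (fun y _ => (hasDerivAt_cutoffPrimitive hp hM y).continuousAt.continuousWithinAt)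
        (fun y _ => (hasDerivAt_cutoffPrimitive hp hM y).differentiableAt.differentiableWithinAt)
        fun y hy => ?_
      rw [interior_Ici] at hy
      rw [(hasDerivAt_cutoffPrimitive hp hM y).deriv]
      exact (hpos y (hWM.trans hy)).le
    exact h1.trans_le (hmono self_mem_Ici hx hx)
  · have hd : HasDerivAt (cutoff p a M) (p * W ^ (p - 1) - a) W :=
      (hasDerivAt_rpow_sub hp a W).congr_of_eventuallyEq <| by
        filter_upwards [Icc_mem_nhds hW hWM] with x hx using cutoff_of_mem hx
    have hgW : cutoff p a M W = 0 := by
      rw [cutoff_of_mem ⟨hW.le, hWM.le⟩, rpow_eq_mul hp hW.le, hWa]; ring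
    rw [hWa] at hd
    have hs := (hasDerivAt_iff_tendsto_slope.1 hd).eventually_const_lt
      (show 1 < p * a - a by linarith)
    rw [eventually_nhdsWithin_iff, Metric.eventually_nhds_iff] at hs
    obtain ⟨ε, hε, h⟩ := hs
    refine ⟨ε / 2, by linarith, fun v hv => ?_⟩
    rcases eq_or_ne v 0 with rfl | hv0
    · simp
    have h1 := @h (W + v) (by rw [Real.dist_eq, add_sub_cancel_left]; linarith) (by simpa using hv0)
    rw [slope_def_field, hgW, sub_zero, add_sub_cancel_left] at h1
    have h2 : cutoff p a M (W + v) * v = cutoff p a M (W + v) / v * v ^ 2 := by field_simp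
    rw [h2]
    have : 0 < v ^ 2 := by positivity
    nlinarith

/-- A solution of `w″ = k coth t · w′ - w ^ p + a w`, regular at `t = 0`, decaying at infinity and
crossing `W` exactly `2 n` times. -/
structure IsConnection (p a k W : ℝ) (n : ℕ) (w y : ℝ → ℝ) : Prop where
  continuous_w : Continuous w
  continuous_y : Continuous y
  w_zero_lt : w 0 < W
  y_zero : y 0 = 0
  deriv_w : ∀ t, 0 < t → HasDerivAt w (y t) t
  deriv_y : ∀ t, 0 < t →
    HasDerivAt y (k * (Real.cosh t / Real.sinh t) * y t - (w t ^ p - a * w t)) t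
  regular : Tendsto (fun t => y t / t) (𝓝[>] 0) (𝓝 (-(w 0 ^ p - a * w 0) / (1 - k)))
  pos : ∀ t, 0 ≤ t → 0 < w t
  sq_le : ∀ t, 0 ≤ t → y t ^ 2 ≤ a * w t ^ 2
  tendsto_w : Tendsto w atTop (𝓝 0)
  eventually_neg : ∀ᶠ t in atTop, y t < 0
  encard_eq : {t | 0 < t ∧ w t = W}.encard = (2 * n : ℕ)

theorem exists_isConnection {k : ℝ} (hp : 1 < p) (hW : 0 < W) (hWa : W ^ (p - 1) = a)
    (ha : 1 < (p - 1) * a) (hk : 0 < k) (hk1 : k < 1) {n : ℕ} (hn : 1 ≤ n) :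
    ∃ w y, IsConnection p a k W n w y := by
  have ha0 : 0 < a := hWa ▸ Real.rpow_pos_of_pos hW _
  have hp1 : 0 < p - 1 := by linarith
  set M : ℝ := (a * (p + 1)) ^ (p - 1)⁻¹ with hMdef
  have hap : 0 < a * (p + 1) := by positivity
  have hM : 0 < M := Real.rpow_pos_of_pos hap _
  have hMa : M ^ (p - 1) = a * (p + 1) := Real.rpow_inv_rpow hap.le hp1.ne'
  have H := isWell_cutoff hp hW hWa ha hM hMa
  obtain ⟨K, hK⟩ := H.lip
  obtain ⟨C, hC⟩ : ∃ C, ∀ x, |cutoff p a M x| ≤ C := by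
    obtain ⟨C, hC⟩ := isCompact_Icc.exists_bound_of_continuousOn
      (hK.continuous.continuousOn (s := Icc 0 M))
    refine ⟨C, fun x => ?_⟩
    have hm : max 0 (min x M) ∈ Icc 0 M := ⟨le_max_left _ _, max_le hM.le (min_le_right _ _)⟩
    have := hC _ hm
    rw [cutoff_of_mem hm] at this
    exact this
  obtain ⟨w, y, F⟩ := exists_isFlow hk hk1 hK hC
  obtain ⟨b, hb, hE, hlim, hneg, henc⟩ := F.exists_connection H hk hk1 hn
  have hpos : ∀ t, 0 ≤ t → 0 < w b t := fun t ht => F.pos_of_energy_nonpos H hk hb ht (hE t ht)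
  have hmem : ∀ t, 0 ≤ t → w b t ∈ Icc 0 M := fun t ht =>
    ⟨(hpos t ht).le, (IsFlow.lt_of_energy_nonpos H (hE t ht)).le⟩
  refine ⟨w b, y b, F.cont_w b, F.cont_y b, by rw [F.w_zero]; exact hb.2, F.y_zero b, F.deriv_w b,
    fun t ht => ?_, ?_, hpos, fun t ht => ?_, hlim, hneg, henc⟩
  · have := F.deriv_y b t ht
    rwa [cutoff_of_mem (hmem t ht.le)] at this
  · rw [← cutoff_of_mem (hmem 0 le_rfl), F.w_zero]
    exact F.regular b
  · have h := hE t ht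
    rw [IsFlow.energy, cutoffPrimitive_of_mem hp hM (hmem t ht)] at h
    have h1 : 0 < w b t ^ (p + 1) / (p + 1) :=
      div_pos (Real.rpow_pos_of_pos (hpos t ht) _) (by linarith)
    linarith

end

/-- A bounded function with `ψ′ ≥ l ψ - Γ e^{-δ t}` and `l > 0` is at most
`Γ e^{-δ t} / (l + δ)`. -/
lemma le_of_bounded_of_deriv_ge {ψ ψ' : ℝ → ℝ} {l Γ δ B T : ℝ} (hl : 0 < l) (hδ : 0 ≤ δ)
    (hd : ∀ t, T ≤ t → HasDerivAt ψ (ψ' t) t) (hB : ∀ t, T ≤ t → |ψ t| ≤ B)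
    (h : ∀ t, T ≤ t → l * ψ t - Γ * Real.exp (-(δ * t)) ≤ ψ' t) :
    ∀ t, T ≤ t → ψ t ≤ Γ / (l + δ) * Real.exp (-(δ * t)) := by
  have he : ∀ c t : ℝ, HasDerivAt (fun t => Real.exp (-(c * t))) (-c * Real.exp (-(c * t))) t := by
    intro c t
    have := ((hasDerivAt_id t).const_mul c).neg.exp
    simpa [mul_comm] using this
  set q : ℝ → ℝ := fun t => ψ t * Real.exp (-(l * t)) - Γ / (l + δ) * Real.exp (-((l + δ) * t))
    with hq
  have hqd : ∀ t, T ≤ t → HasDerivAt q (ψ' t * Real.exp (-(l * t)) +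
      ψ t * (-l * Real.exp (-(l * t))) -
        Γ / (l + δ) * (-(l + δ) * Real.exp (-((l + δ) * t)))) t := fun t ht =>
    ((hd t ht).mul (he l t)).sub ((he (l + δ) t).const_mul _)
  have hmono : MonotoneOn q (Ici T) := by
    refine monotoneOn_of_deriv_nonneg (convex_Ici T)
      (fun t ht => (hqd t ht).continuousAt.continuousWithinAt)
      (fun t ht => (hqd t (interior_subset ht)).differentiableAt.differentiableWithinAt)
      fun t ht => ?_
    have ht : T ≤ t := interior_subset ht
    rw [(hqd t ht).deriv]
    have e : Real.exp (-((l + δ) * t)) = Real.exp (-(l * t)) * Real.exp (-(δ * t)) := by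
      rw [← Real.exp_add]; ring_nf
    have e2 : Γ / (l + δ) * (-(l + δ) * Real.exp (-((l + δ) * t))) =
        -Γ * Real.exp (-((l + δ) * t)) := by
      have : l + δ ≠ 0 := by positivity
      field_simp
    rw [e2, e]
    have := mul_nonneg (sub_nonneg.2 (h t ht)) (Real.exp_pos (-(l * t))).le
    linarith
  have hexp : ∀ c : ℝ, 0 < c → Tendsto (fun t => Real.exp (-(c * t))) atTop (𝓝 0) := fun c hc =>
    Real.tendsto_exp_neg_atTop_nhds_zero.comp (tendsto_id.const_mul_atTop hc)
  have hlim : Tendsto q atTop (𝓝 0) := by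
    have h1 : Tendsto (fun t => ψ t * Real.exp (-(l * t))) atTop (𝓝 0) := by
      refine squeeze_zero_norm' (a := fun t => B * Real.exp (-(l * t))) ?_ ?_
      · filter_upwards [eventually_ge_atTop T] with t ht
        rw [norm_mul, Real.norm_eq_abs, Real.norm_eq_abs, Real.abs_exp]
        exact mul_le_mul_of_nonneg_right (hB t ht) (Real.exp_pos _).le
      · simpa using (hexp l hl).const_mul B
    have h2 := (hexp (l + δ) (by positivity)).const_mul (Γ / (l + δ))
    simpa using h1.sub h2
  intro t ht
  have h1 : q t ≤ 0 := ge_of_tendsto hlim (by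
    filter_upwards [eventually_ge_atTop t] with s hs using hmono ht (ht.trans hs) hs)
  have e : Real.exp (-((l + δ) * t)) = Real.exp (-(l * t)) * Real.exp (-(δ * t)) := by
    rw [← Real.exp_add]; ring_nf
  have hp := Real.exp_pos (-(l * t))
  rw [hq] at h1
  simp only at h1
  rw [e] at h1
  refine le_of_mul_le_mul_right ?_ hp
  linarith

namespace IsConnection

variable {p a k W α : ℝ} {n : ℕ} {w y : ℝ → ℝ}

lemma hasDerivAt_ratio (h : IsConnection p a k W n w y) (hp : 1 < p) {t : ℝ} (ht : 0 < t) :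
    HasDerivAt (fun t => y t / w t) (k * (Real.cosh t / Real.sinh t) * (y t / w t) -
      w t ^ (p - 1) + a - (y t / w t) ^ 2) t := by
  have hw := h.pos t ht.le
  have := (h.deriv_y t ht).div (h.deriv_w t ht) hw.ne'
  convert! this using 1
  rw [rpow_eq_mul hp hw.le]
  field_simp
  ring

/-- The trajectory decays like `e^{-α t}` at infinity. -/
theorem asymptotics (h : IsConnection p a k W n w y) (hp : 1 < p) (hk : 0 < k) (hα : 0 < α)
    (hαp : α * (p - 1) = 2) (ha : a = α * (α + k)) :
    Tendsto (fun t => y t / w t) atTop (𝓝 (-α)) ∧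
      ∃ C > 0, Tendsto (fun t => w t * Real.exp (α * t)) atTop (𝓝 C) := by
  have ha0 : 0 < a := by rw [ha]; positivity
  obtain ⟨T, hT⟩ := eventually_atTop.1 (h.eventually_neg.and (eventually_ge_atTop 1))
  have hT1 : 1 ≤ T := (hT T le_rfl).2
  have hpos : ∀ t, T ≤ t → 0 < t := fun t ht => by linarith
  have hw : ∀ t, T ≤ t → 0 < w t := fun t ht => h.pos t (hpos t ht).le
  set ψ : ℝ → ℝ := fun t => y t / w t + α with hψ
  set P : ℝ → ℝ := fun t => k * (α - ψ t) * (Real.cosh t / Real.sinh t - 1) + w t ^ (p - 1) with hP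
  have hψd : ∀ t, T ≤ t → HasDerivAt ψ (ψ t * (2 * α + k - ψ t) - P t) t := by
    intro t ht
    convert! (h.hasDerivAt_ratio hp (hpos t ht)).add_const α using 1
    simp only [hψ, hP, ha]
    ring
  have hφ : ∀ t, T ≤ t → y t / w t ≤ 0 ∧ -√a ≤ y t / w t := by
    intro t ht
    refine ⟨div_nonpos_of_nonpos_of_nonneg (hT t ht).1.le (hw t ht).le, ?_⟩
    have h1 : |y t / w t| ≤ √a := by
      refine Real.abs_le_sqrt ?_
      rw [div_pow, div_le_iff₀ (pow_pos (hw t ht) 2)]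
      exact h.sq_le t (hpos t ht).le
    exact (abs_le.1 h1).1
  have hψα : ∀ t, T ≤ t → ψ t ≤ α := fun t ht => by
    have := (hφ t ht).1
    simp only [hψ]; linarith
  have hψa : ∀ t, T ≤ t → α - ψ t ≤ √a := fun t ht => by
    have := (hφ t ht).2
    simp only [hψ]; linarith
  have hP0 : ∀ t, T ≤ t → 0 ≤ P t := by
    intro t ht
    have h1 := one_le_coth (hpos t ht)
    exact add_nonneg (mul_nonneg (mul_nonneg hk.le (sub_nonneg.2 (hψα t ht)))
      (sub_nonneg.2 h1)) (Real.rpow_nonneg (hw t ht).le _)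
  have hPle : ∀ t, T ≤ t → P t ≤ k * √a * Real.exp (-t) + w t ^ (p - 1) := by
    intro t ht
    have h1 := coth_le_one_add_exp (hT1.trans ht)
    have h2 : k * (α - ψ t) * (Real.cosh t / Real.sinh t - 1) ≤ k * √a * Real.exp (-t) :=
      mul_le_mul (mul_le_mul_of_nonneg_left (hψa t ht) hk.le) (by linarith)
        (sub_nonneg.2 (one_le_coth (hpos t ht))) (by positivity)
    simp only [hP]; linarith
  have hexp : ∀ c t : ℝ, HasDerivAt (fun t => Real.exp (c * t)) (c * Real.exp (c * t)) t := by
    intro c t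
    have := ((hasDerivAt_id t).const_mul c).exp
    simpa [mul_comm] using this
  have hψ0 : ∀ t, T ≤ t → 0 ≤ ψ t := by
    intro t ht
    by_contra! hneg
    set c := 2 * α + k with hc
    have hc0 : 0 < c := by positivity
    have hd : ∀ s, T ≤ s → HasDerivAt (fun s => ψ s * Real.exp (-c * s))
        ((ψ s * (c - ψ s) - P s) * Real.exp (-c * s) + ψ s * (-c * Real.exp (-c * s))) s :=
      fun s hs => (hψd s hs).mul (hexp (-c) s)
    have hanti : AntitoneOn (fun s => ψ s * Real.exp (-c * s)) (Ici T) := by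
      refine antitoneOn_of_deriv_nonpos (convex_Ici T)
        (fun s hs => (hd s hs).continuousAt.continuousWithinAt)
        (fun s hs => (hd s (interior_subset hs)).differentiableAt.differentiableWithinAt)
        fun s hs => ?_
      have hs : T ≤ s := interior_subset hs
      rw [(hd s hs).deriv]
      have h1 := mul_nonneg (add_nonneg (hP0 s hs) (sq_nonneg (ψ s))) (Real.exp_pos (-c * s)).le
      linarith
    have h1 : Tendsto (fun s => ψ t * Real.exp (-c * t) * Real.exp (c * s)) atTop atBot :=
      (Real.tendsto_exp_atTop.comp (tendsto_id.const_mul_atTop hc0)).const_mul_atTop_of_neg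
        (mul_neg_of_neg_of_pos hneg (Real.exp_pos _))
    obtain ⟨s, hs, hst⟩ := ((h1.eventually_lt_atBot (α - √a)).and (eventually_ge_atTop t)).exists
    have h2 := hanti (mem_Ici.2 ht) (mem_Ici.2 (ht.trans hst)) hst
    simp only at h2
    have h3 := mul_le_mul_of_nonneg_right h2 (Real.exp_pos (c * s)).le
    have h4 : Real.exp (-c * s) * Real.exp (c * s) = 1 := by rw [← Real.exp_add]; simp
    rw [mul_assoc (ψ s), h4, mul_one] at h3
    linarith [hψa s (ht.trans hst)]
  have hψabs : ∀ t, T ≤ t → |ψ t| ≤ α := fun t ht =>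
    abs_le.2 ⟨by linarith [hψ0 t ht], hψα t ht⟩
  have hl : 0 < α + k := by positivity
  have hψlow : ∀ t, T ≤ t → (α + k) * ψ t - P t ≤ ψ t * (2 * α + k - ψ t) - P t := by
    intro t ht
    have := mul_nonneg (hψ0 t ht) (sub_nonneg.2 (hψα t ht))
    linarith
  have hp1 : 0 < p - 1 := by linarith
  have hPlim : Tendsto (fun t => k * √a * Real.exp (-t) + w t ^ (p - 1)) atTop (𝓝 0) := by
    have h1 := Real.tendsto_exp_neg_atTop_nhds_zero.const_mul (k * √a)
    have h2 := h.tendsto_w.rpow_const (p := p - 1) (Or.inr hp1.le)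
    rw [Real.zero_rpow hp1.ne'] at h2
    simpa using h1.add h2
  obtain ⟨T₁, hT₁⟩ := eventually_atTop.1 ((hPlim.eventually_le_const
    (show 0 < (α + k) * α / 2 by positivity)).and (eventually_ge_atTop T))
  have hTT₁ : T ≤ T₁ := (hT₁ T₁ le_rfl).2
  have hhalf : ∀ t, T₁ ≤ t → ψ t ≤ α / 2 := by
    intro t ht
    have := le_of_bounded_of_deriv_ge (Γ := (α + k) * α / 2) (δ := 0) (T := T₁) hl le_rfl
      (fun s hs => hψd s (hTT₁.trans hs)) (fun s hs => hψabs s (hTT₁.trans hs))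
      (fun s hs => by
        have h1 := hψlow s (hTT₁.trans hs)
        have h2 := hPle s (hTT₁.trans hs)
        have h3 := (hT₁ s hs).1
        simp only [zero_mul, neg_zero, Real.exp_zero, mul_one]
        linarith) t ht
    simp only [zero_mul, neg_zero, Real.exp_zero, mul_one, add_zero] at this
    refine this.trans (le_of_eq ?_)
    field_simp
  have hwexp : ∀ c t : ℝ, T ≤ t → HasDerivAt (fun t => w t * Real.exp (c * t))
      ((ψ t - α + c) * (w t * Real.exp (c * t))) t := by
    intro c t ht
    convert! (h.deriv_w t (hpos t ht)).mul (hexp c t) using 1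
    have := (hw t ht).ne'
    simp only [hψ]
    field_simp
    ring
  obtain ⟨Γ, hΓ⟩ : ∃ Γ, ∀ t, T₁ ≤ t → P t ≤ Γ * Real.exp (-(1 * t)) := by
    have hanti : AntitoneOn (fun t => w t * Real.exp (α / 2 * t)) (Ici T₁) := by
      refine antitoneOn_of_deriv_nonpos (convex_Ici T₁)
        (fun s hs => (hwexp _ s (hTT₁.trans hs)).continuousAt.continuousWithinAt)
        (fun s hs => (hwexp _ s (hTT₁.trans
          (interior_subset hs))).differentiableAt.differentiableWithinAt) fun s hs => ?_
      have hs : T₁ ≤ s := interior_subset hs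
      rw [(hwexp _ s (hTT₁.trans hs)).deriv]
      exact mul_nonpos_of_nonpos_of_nonneg (by linarith [hhalf s hs])
        (mul_pos (hw s (hTT₁.trans hs)) (Real.exp_pos _)).le
    set K := w T₁ * Real.exp (α / 2 * T₁) with hK
    have hK0 : 0 < K := mul_pos (hw T₁ hTT₁) (Real.exp_pos _)
    refine ⟨k * √a + K ^ (p - 1), fun t ht => (hPle t (hTT₁.trans ht)).trans ?_⟩
    have h1 : w t * Real.exp (α / 2 * t) ≤ K := hanti self_mem_Ici ht ht
    have h2 : w t ≤ K * Real.exp (-(α / 2 * t)) := by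
      rw [Real.exp_neg, ← div_eq_mul_inv, le_div_iff₀ (Real.exp_pos _)]
      exact h1
    have h3 : w t ^ (p - 1) ≤ K ^ (p - 1) * Real.exp (-t) := by
      refine (Real.rpow_le_rpow (hw t (hTT₁.trans ht)).le h2 hp1.le).trans (le_of_eq ?_)
      rw [Real.mul_rpow hK0.le (Real.exp_pos _).le, ← Real.exp_mul]
      congr 2
      linear_combination (-t / 2) * hαp
    rw [one_mul]
    linarith
  set Γ' := Γ / (α + k + 1) with hΓ'
  have hψexp : ∀ t, T₁ ≤ t → ψ t ≤ Γ' * Real.exp (-(1 * t)) :=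
    le_of_bounded_of_deriv_ge hl zero_le_one
      (fun s hs => hψd s (hTT₁.trans hs)) (fun s hs => hψabs s (hTT₁.trans hs))
      (fun s hs => by
        have h1 := hψlow s (hTT₁.trans hs)
        have h2 := hΓ s hs
        linarith)
  refine ⟨?_, ?_⟩
  · have h1 : Tendsto ψ atTop (𝓝 0) := by
      refine tendsto_of_tendsto_of_tendsto_of_le_of_le' tendsto_const_nhds
        (h := fun t => Γ' * Real.exp (-(1 * t))) ?_ ?_ ?_
      · simpa using Real.tendsto_exp_neg_atTop_nhds_zero.const_mul Γ'
      · filter_upwards [eventually_ge_atTop T] with t ht using hψ0 t ht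
      · filter_upwards [eventually_ge_atTop T₁] with t ht using hψexp t ht
    have h2 := h1.sub_const α
    rw [zero_sub] at h2
    exact h2.congr fun t => by simp [hψ]
  · have hmono : MonotoneOn (fun t => w t * Real.exp (α * t)) (Ici T₁) := by
      refine monotoneOn_of_deriv_nonneg (convex_Ici T₁)
        (fun s hs => (hwexp _ s (hTT₁.trans hs)).continuousAt.continuousWithinAt)
        (fun s hs => (hwexp _ s (hTT₁.trans
          (interior_subset hs))).differentiableAt.differentiableWithinAt) fun s hs => ?_
      have hs : T ≤ s := hTT₁.trans (interior_subset hs)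
      rw [(hwexp _ s hs).deriv]
      exact mul_nonneg (by linarith [hψ0 s hs]) (mul_pos (hw s hs) (Real.exp_pos _)).le
    have hd : ∀ s, T₁ ≤ s → HasDerivAt
        (fun t => w t * Real.exp (α * t) * Real.exp (Γ' * Real.exp (-1 * t)))
        ((ψ s - α + α) * (w s * Real.exp (α * s)) * Real.exp (Γ' * Real.exp (-1 * s)) +
          w s * Real.exp (α * s) * (Real.exp (Γ' * Real.exp (-1 * s)) *
            (Γ' * (-1 * Real.exp (-1 * s))))) s := fun s hs =>
      (hwexp α s (hTT₁.trans hs)).mul ((hexp (-1) s).const_mul Γ').exp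
    have hanti : AntitoneOn
        (fun t => w t * Real.exp (α * t) * Real.exp (Γ' * Real.exp (-1 * t))) (Ici T₁) := by
      refine antitoneOn_of_deriv_nonpos (convex_Ici T₁)
        (fun s hs => (hd s hs).continuousAt.continuousWithinAt)
        (fun s hs => (hd s (interior_subset hs)).differentiableAt.differentiableWithinAt)
        fun s hs => ?_
      have hs : T₁ ≤ s := interior_subset hs
      rw [(hd s hs).deriv]
      have h1 := hψexp s hs
      rw [neg_mul_eq_neg_mul 1 s] at h1
      have h2 : 0 < w s * Real.exp (α * s) * Real.exp (Γ' * Real.exp (-1 * s)) :=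
        mul_pos (mul_pos (hw s (hTT₁.trans hs)) (Real.exp_pos _)) (Real.exp_pos _)
      have h3 := mul_nonneg (sub_nonneg.2 h1) h2.le
      linarith
    have hΓ0 : 0 ≤ Γ' := by
      have := (hψ0 T₁ hTT₁).trans (hψexp T₁ le_rfl)
      exact nonneg_of_mul_nonneg_left this (Real.exp_pos _)
    set B := w T₁ * Real.exp (α * T₁) * Real.exp (Γ' * Real.exp (-1 * T₁)) with hB
    have hbound : ∀ t, T₁ ≤ t → w t * Real.exp (α * t) ≤ B := by
      intro t ht
      have h1 : w t * Real.exp (α * t) * Real.exp (Γ' * Real.exp (-1 * t)) ≤ B :=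
        hanti self_mem_Ici ht ht
      refine le_trans ?_ h1
      refine le_mul_of_one_le_right (mul_pos (hw t (hTT₁.trans ht)) (Real.exp_pos _)).le ?_
      exact Real.one_le_exp (mul_nonneg hΓ0 (Real.exp_pos _).le)
    have hconv : ∃ C, Tendsto (fun t => w (max t T₁) * Real.exp (α * max t T₁)) atTop (𝓝 C) := by
      refine ⟨_, tendsto_atTop_ciSup (fun r s hrs => hmono (le_max_right r T₁)
        (le_max_right s T₁) (max_le_max_right T₁ hrs)) ⟨B, ?_⟩⟩
      rintro _ ⟨s, rfl⟩
      exact hbound _ (le_max_right _ _)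
    obtain ⟨C, hC⟩ := hconv
    have hC' : Tendsto (fun t => w t * Real.exp (α * t)) atTop (𝓝 C) := by
      refine hC.congr' ?_
      filter_upwards [eventually_ge_atTop T₁] with t ht
      rw [max_eq_left ht]
    refine ⟨C, ?_, hC'⟩
    have h1 : w T₁ * Real.exp (α * T₁) ≤ C := ge_of_tendsto hC' (by
      filter_upwards [eventually_ge_atTop T₁] with t ht using hmono self_mem_Ici ht ht)
    exact (mul_pos (hw T₁ hTT₁) (Real.exp_pos _)).trans_le h1

end IsConnection

lemma extendFrom_Ioo_eq {f : ℝ → ℝ} (hf : ContinuousOn f (Ioo 0 1)) :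
    EqOn (extendFrom (Ioo (0 : ℝ) 1) f) f (Ioo 0 1) := fun x hx =>
  extendFrom_eq (subset_closure hx) (hf x hx)

/-- If `f' = g` inside `(0, 1)` and both functions have limits at the endpoints, then the
continuous extension of `f` is differentiable on `[0, 1]`, with derivative that of `g`. -/
lemma hasDerivWithinAt_extendFrom {f g : ℝ → ℝ} {f₀ f₁ g₀ g₁ : ℝ}
    (hd : ∀ x ∈ Ioo (0 : ℝ) 1, HasDerivAt f (g x) x)
    (hf₀ : Tendsto f (𝓝[>] 0) (𝓝 f₀)) (hf₁ : Tendsto f (𝓝[<] 1) (𝓝 f₁))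
    (hg₀ : Tendsto g (𝓝[>] 0) (𝓝 g₀)) (hg₁ : Tendsto g (𝓝[<] 1) (𝓝 g₁)) :
    HasDerivWithinAt (extendFrom (Ioo 0 1) f) g₀ (Ici 0) 0 ∧
    HasDerivWithinAt (extendFrom (Ioo 0 1) f) g₁ (Iic 1) 1 ∧
    ∀ x ∈ Ioo (0 : ℝ) 1, HasDerivAt (extendFrom (Ioo 0 1) f) (g x) x := by
  have hfc : ContinuousOn f (Ioo 0 1) := fun x hx => (hd x hx).continuousAt.continuousWithinAt
  have hc := continuousOn_Icc_extendFrom_Ioo hfc hf₀ hf₁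
  have hdE : ∀ x ∈ Ioo (0 : ℝ) 1, HasDerivAt (extendFrom (Ioo 0 1) f) (g x) x := fun x hx =>
    (hd x hx).congr_of_eventuallyEq <| by
      filter_upwards [isOpen_Ioo.mem_nhds hx] with y hy using extendFrom_Ioo_eq hfc hy
  have hdiff : DifferentiableOn ℝ (extendFrom (Ioo 0 1) f) (Ioo 0 1) := fun x hx =>
    (hdE x hx).differentiableAt.differentiableWithinAt
  have hm0 : Ioo (0 : ℝ) 1 ∈ 𝓝[>] (0 : ℝ) := Ioo_mem_nhdsGT one_pos
  have hm1 : Ioo (0 : ℝ) 1 ∈ 𝓝[<] (1 : ℝ) := Ioo_mem_nhdsLT one_pos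
  refine ⟨hasDerivWithinAt_Ici_of_tendsto_deriv hdiff
    ((hc 0 (by simp)).mono Ioo_subset_Icc_self) hm0 (hg₀.congr' ?_),
    hasDerivWithinAt_Iic_of_tendsto_deriv hdiff
    ((hc 1 (by simp)).mono Ioo_subset_Icc_self) hm1 (hg₁.congr' ?_), hdE⟩
  · filter_upwards [hm0] with x hx using (hdE x hx).deriv.symm
  · filter_upwards [hm1] with x hx using (hdE x hx).deriv.symm

lemma derivWithin_extendFrom {f g : ℝ → ℝ} {f₀ f₁ g₀ g₁ : ℝ}
    (hd : ∀ x ∈ Ioo (0 : ℝ) 1, HasDerivAt f (g x) x) (hgc : ContinuousOn g (Ioo 0 1))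
    (hf₀ : Tendsto f (𝓝[>] 0) (𝓝 f₀)) (hf₁ : Tendsto f (𝓝[<] 1) (𝓝 f₁))
    (hg₀ : Tendsto g (𝓝[>] 0) (𝓝 g₀)) (hg₁ : Tendsto g (𝓝[<] 1) (𝓝 g₁)) :
    ∀ x ∈ Icc (0 : ℝ) 1, HasDerivWithinAt (extendFrom (Ioo 0 1) f)
      (extendFrom (Ioo 0 1) g x) (Icc 0 1) x := by
  obtain ⟨h0, h1, h⟩ := hasDerivWithinAt_extendFrom hd hf₀ hf₁ hg₀ hg₁
  intro x hx
  rcases eq_or_lt_of_le hx.1 with rfl | hx0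
  · rw [eq_lim_at_left_extendFrom_Ioo one_pos hg₀]
    exact h0.mono Icc_subset_Ici_self
  rcases eq_or_lt_of_le hx.2 with rfl | hx1
  · rw [eq_lim_at_right_extendFrom_Ioo one_pos hg₁]
    exact h1.mono Icc_subset_Iic_self
  · rw [extendFrom_Ioo_eq hgc ⟨hx0, hx1⟩]
    exact (h x ⟨hx0, hx1⟩).hasDerivWithinAt

/-- A function on `(0, 1)` all of whose derivatives up to order two have limits at the endpoints
extends to a `C²` function on `[0, 1]`. -/
lemma exists_contDiffOn_two_extension {f g h : ℝ → ℝ} {f₀ f₁ g₀ g₁ h₀ h₁ : ℝ}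
    (hf : ∀ x ∈ Ioo (0 : ℝ) 1, HasDerivAt f (g x) x)
    (hg : ∀ x ∈ Ioo (0 : ℝ) 1, HasDerivAt g (h x) x) (hh : ContinuousOn h (Ioo 0 1))
    (hf₀ : Tendsto f (𝓝[>] 0) (𝓝 f₀)) (hf₁ : Tendsto f (𝓝[<] 1) (𝓝 f₁))
    (hg₀ : Tendsto g (𝓝[>] 0) (𝓝 g₀)) (hg₁ : Tendsto g (𝓝[<] 1) (𝓝 g₁))
    (hh₀ : Tendsto h (𝓝[>] 0) (𝓝 h₀)) (hh₁ : Tendsto h (𝓝[<] 1) (𝓝 h₁)) :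
    ∃ u : ℝ → ℝ, ContDiffOn ℝ 2 u (Icc 0 1) ∧ EqOn u f (Ioo 0 1) ∧ u 0 = f₀ ∧ u 1 = f₁ ∧
      derivWithin u (Ici 0) 0 = g₀ := by
  have hgc : ContinuousOn g (Ioo 0 1) := fun x hx => (hg x hx).continuousAt.continuousWithinAt
  have hfc : ContinuousOn f (Ioo 0 1) := fun x hx => (hf x hx).continuousAt.continuousWithinAt
  have hud : UniqueDiffOn ℝ (Icc (0 : ℝ) 1) := uniqueDiffOn_Icc one_pos
  have key : ∀ {m : ℕ} {v v' : ℝ → ℝ}, ContDiffOn ℝ m v' (Icc 0 1) →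
      (∀ x ∈ Icc (0 : ℝ) 1, HasDerivWithinAt v (v' x) (Icc 0 1) x) →
      ContDiffOn ℝ (m + 1) v (Icc 0 1) := fun hv' hv =>
    (contDiffOn_succ_iff_derivWithin hud).2 ⟨fun x hx => (hv x hx).differentiableWithinAt,
      by simp, hv'.congr fun x hx => (hv x hx).derivWithin (hud x hx)⟩
  have c0 : ContDiffOn ℝ (0 : ℕ) (extendFrom (Ioo 0 1) h) (Icc 0 1) :=
    contDiffOn_zero.2 (continuousOn_Icc_extendFrom_Ioo hh hh₀ hh₁)
  have c1 := key c0 (derivWithin_extendFrom hg hh hg₀ hg₁ hh₀ hh₁)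
  have c2 := key (m := 1) (by simpa using c1) (derivWithin_extendFrom hf hgc hf₀ hf₁ hg₀ hg₁)
  refine ⟨extendFrom (Ioo 0 1) f, c2.of_le (by norm_num), extendFrom_Ioo_eq hfc,
    eq_lim_at_left_extendFrom_Ioo one_pos hf₀, eq_lim_at_right_extendFrom_Ioo one_pos hf₁, ?_⟩
  exact (hasDerivWithinAt_extendFrom hf hf₀ hf₁ hg₀ hg₁).1.derivWithin
    (uniqueDiffWithinAt_Ici 0)

/-- L'Hôpital's rule at `0` for `(1 - x²) g / x`, when `x ↦ x^m (1 - x²) g` has a controlled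
derivative. -/
lemma tendsto_div_self_of_radial {g h F : ℝ → ℝ} {m : ℕ} {c l : ℝ} (hm : 1 ≤ m)
    (hg : ∀ x ∈ Ioo (0 : ℝ) 1, HasDerivAt g (h x) x)
    (hF : ∀ x ∈ Ioo (0 : ℝ) 1, (1 - x ^ 2) * h x + (m / x - c * x) * g x = F x)
    (hxg : Tendsto (fun x => x * g x) (𝓝[>] 0) (𝓝 0)) (hFl : Tendsto F (𝓝[>] 0) (𝓝 l)) :
    Tendsto (fun x => g x / x) (𝓝[>] 0) (𝓝 (l / (m + 1))) := by
  have hm0 : Ioo (0 : ℝ) 1 ∈ 𝓝[>] (0 : ℝ) := Ioo_mem_nhdsGT one_pos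
  have hx0 : Tendsto (fun x : ℝ => x) (𝓝[>] 0) (𝓝 0) := tendsto_id.mono_left nhdsWithin_le_nhds
  have h1x : Tendsto (fun x : ℝ => 1 - x ^ 2) (𝓝[>] 0) (𝓝 1) := by
    simpa using (hx0.pow 2).const_sub 1
  have hlop : Tendsto (fun x => x ^ m * ((1 - x ^ 2) * g x) / x ^ (m + 1)) (𝓝[>] 0)
      (𝓝 (l / (m + 1))) := by
    refine HasDerivAt.lhopital_zero_nhdsGT
      (f' := fun x => x ^ m * (F x + (c - m - 2) * (x * g x)))
      (g' := fun x => (m + 1) * x ^ m) ?_ ?_ ?_ ?_ ?_ ?_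
    · filter_upwards [hm0] with x hx
      have := (hasDerivAt_pow m x).mul ((((hasDerivAt_pow 2 x).const_sub 1)).mul (hg x hx))
      convert! this using 1
      rw [← hF x hx]
      obtain ⟨j, rfl⟩ : ∃ j, m = j + 1 := ⟨m - 1, by omega⟩
      have : x ≠ 0 := hx.1.ne'
      push_cast
      field_simp
      simp
      ring
    · filter_upwards with x
      simpa using hasDerivAt_pow (m + 1) x
    · filter_upwards [hm0] with x hx
      have := hx.1
      positivity
    · obtain ⟨j, rfl⟩ : ∃ j, m = j + 1 := ⟨m - 1, by omega⟩
      have := (hx0.pow j).mul (h1x.mul hxg)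
      rw [mul_zero, mul_zero] at this
      refine this.congr fun x => ?_
      ring
    · have := hx0.pow (m + 1)
      simpa using this
    · have h2 : Tendsto (fun x => (F x + (c - m - 2) * (x * g x)) / (m + 1 : ℝ)) (𝓝[>] 0)
          (𝓝 (l / (m + 1))) := by
        simpa using (hFl.add (hxg.const_mul (c - m - 2))).div_const (m + 1 : ℝ)
      refine h2.congr' ?_
      filter_upwards [hm0] with x hx
      have := hx.1.ne'
      field_simp
  have := hlop.div h1x one_ne_zero
  rw [div_one] at this
  refine this.congr' ?_
  filter_upwards [hm0] with x hx
  have := hx.1.ne'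
  have h2 : 1 - x ^ 2 ≠ 0 := by nlinarith [hx.1, hx.2]
  simp only [Pi.div_apply]
  field_simp
  ring

lemma hasDerivAt_rpow_neg_mul {α x : ℝ} {v : ℝ → ℝ} {v' : ℝ} (hx : 0 < x)
    (hv : HasDerivAt v v' x) :
    HasDerivAt (fun x => x ^ (-α) * v x) (x ^ (-α) * (v' - α * v x / x)) x := by
  have := (Real.hasDerivAt_rpow_const (p := -α) (Or.inl hx.ne')).mul hv
  convert! this using 1
  rw [Real.rpow_sub_one hx.ne']
  field_simp
  ring

/-- The profile equation in the unknown `v = ρ^α u`, written as the first order system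
`v′ = -h/ρ²`, `h′ = -q/ρ²`. -/
lemma exists_profile_of_system {p α b C h₁ q₁ : ℝ} {m : ℕ} (hm : 1 ≤ m) (hp : 1 < p)
    (hαp : α * (p - 1) = 2) {v h q : ℝ → ℝ}
    (hvd : ∀ x ∈ Ioo (0 : ℝ) 1, HasDerivAt v (-h x / x ^ 2) x)
    (hhd : ∀ x ∈ Ioo (0 : ℝ) 1, HasDerivAt h (-q x / x ^ 2) x)
    (hqc : ContinuousOn q (Ioo 0 1)) (hvpos : ∀ x ∈ Ioo (0 : ℝ) 1, 0 < v x)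
    (hq : ∀ x ∈ Ioo (0 : ℝ) 1, (1 - x ^ 2) * q x =
      (m - 2 - 2 * α) * x * h x - x ^ 2 * (v x ^ p - α * (m - 1 - α) * v x))
    (hv₁ : Tendsto v (𝓝[<] 1) (𝓝 b)) (hh₁ : Tendsto h (𝓝[<] 1) (𝓝 h₁))
    (hq₁ : Tendsto q (𝓝[<] 1) (𝓝 q₁))
    (hv₀ : Tendsto (fun x => x ^ (-α) * v x) (𝓝[>] 0) (𝓝 C))
    (hh₀ : Tendsto (fun x => x ^ (-α) * h x / x) (𝓝[>] 0) (𝓝 (-α * C))) :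
    ∃ u : ℝ → ℝ, ContDiffOn ℝ 2 u (Icc 0 1) ∧ EqOn u (fun x => x ^ (-α) * v x) (Ioo 0 1) ∧
      u 0 = C ∧ u 1 = b ∧ derivWithin u (Ici 0) 0 = 0 ∧
      ∀ x ∈ Ioo (0 : ℝ) 1, (1 - x ^ 2) * deriv (deriv u) x +
        (m / x - 2 * (α + 1) * x) * deriv u x - α * (α + 1) * u x +
          |u x| ^ (p - 1) * u x = 0 := by
  set U₀ : ℝ → ℝ := fun x => x ^ (-α) * v x with hU₀
  set U₁ : ℝ → ℝ := fun x => x ^ (-α) * (-h x / x ^ 2 - α * v x / x) with hU₁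
  set U₂ : ℝ → ℝ := fun x => x ^ (-α) *
    (q x / x ^ 4 + (2 * α + 2) * h x / x ^ 3 + α * (α + 1) * v x / x ^ 2) with hU₂
  have hm0 : Ioo (0 : ℝ) 1 ∈ 𝓝[>] (0 : ℝ) := Ioo_mem_nhdsGT one_pos
  have hd₀ : ∀ x ∈ Ioo (0 : ℝ) 1, HasDerivAt U₀ (U₁ x) x := fun x hx =>
    hasDerivAt_rpow_neg_mul hx.1 (hvd x hx)
  have hd₁ : ∀ x ∈ Ioo (0 : ℝ) 1, HasDerivAt U₁ (U₂ x) x := by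
    intro x hx
    have h0 : x ≠ 0 := hx.1.ne'
    have e := ((hhd x hx).neg.div (hasDerivAt_pow 2 x) (pow_ne_zero 2 h0)).sub
      (((hvd x hx).const_mul α).div (hasDerivAt_id x) h0)
    convert! hasDerivAt_rpow_neg_mul (α := α) hx.1 e using 1
    simp only [hU₂, Pi.sub_apply, Pi.div_apply, Pi.neg_apply, id]
    congr 1
    field_simp
    push_cast
    ring
  have hode : ∀ x ∈ Ioo (0 : ℝ) 1, (1 - x ^ 2) * U₂ x + (m / x - 2 * (α + 1) * x) * U₁ x =
      α * (α + 1) * U₀ x - U₀ x ^ p := by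
    intro x hx
    have h0 : x ≠ 0 := hx.1.ne'
    have hpw : U₀ x ^ p = x ^ (-α) * (v x ^ p / x ^ 2) := by
      rw [hU₀, Real.mul_rpow (Real.rpow_nonneg hx.1.le _) (hvpos x hx).le,
        ← Real.rpow_mul hx.1.le, show -α * p = -α - (2 : ℕ) by push_cast; linarith,
        Real.rpow_sub_natCast h0]
      ring
    rw [hpw]
    simp only [hU₀, hU₁, hU₂]
    have key : (1 - x ^ 2) * (q x / x ^ 4 + (2 * α + 2) * h x / x ^ 3 + α * (α + 1) * v x / x ^ 2)
        + (m / x - 2 * (α + 1) * x) * (-h x / x ^ 2 - α * v x / x) =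
        α * (α + 1) * v x - v x ^ p / x ^ 2 := by
      have e : (1 - x ^ 2) * (q x / x ^ 4) = ((m - 2 - 2 * α) * x * h x -
          x ^ 2 * (v x ^ p - α * (m - 1 - α) * v x)) / x ^ 4 := by rw [← hq x hx]; ring
      rw [mul_add, mul_add, e]
      field_simp
      ring
    linear_combination x ^ (-α) * key
  have hF : Tendsto (fun x => α * (α + 1) * U₀ x - U₀ x ^ p) (𝓝[>] 0)
      (𝓝 (α * (α + 1) * C - C ^ p)) :=
    (hv₀.const_mul _).sub (hv₀.rpow_const (Or.inr (by linarith)))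
  have hxU : Tendsto (fun x => x * U₁ x) (𝓝[>] 0) (𝓝 0) := by
    have := (hh₀.neg).sub (hv₀.const_mul α)
    rw [show -(-α * C) - α * C = 0 by ring] at this
    refine this.congr' ?_
    filter_upwards [hm0] with x hx
    have := hx.1.ne'
    simp only [hU₀, hU₁]
    field_simp
  have hdiv := tendsto_div_self_of_radial hm hd₁ hode hxU hF
  have hx0 : Tendsto (fun x : ℝ => x) (𝓝[>] 0) (𝓝 0) := tendsto_id.mono_left nhdsWithin_le_nhds
  have hl₁ : Tendsto U₁ (𝓝[>] 0) (𝓝 0) := by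
    have := hdiv.mul hx0
    rw [mul_zero] at this
    refine this.congr' ?_
    filter_upwards [hm0] with x hx
    have := hx.1.ne'
    field_simp
  obtain ⟨c, hl₂⟩ : ∃ c, Tendsto U₂ (𝓝[>] 0) (𝓝 c) := by
    have h1x : Tendsto (fun x : ℝ => 1 - x ^ 2) (𝓝[>] 0) (𝓝 1) := by
      simpa using (hx0.pow 2).const_sub 1
    have := ((hF.sub (hdiv.const_mul (m : ℝ))).add (hxU.const_mul (2 * (α + 1)))).div h1x
      one_ne_zero
    refine ⟨_, this.congr' ?_⟩
    filter_upwards [hm0] with x hx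
    have := hx.1.ne'
    have h2 : 1 - x ^ 2 ≠ 0 := by nlinarith [hx.1, hx.2]
    simp only [Pi.div_apply]
    rw [div_eq_iff h2, ← hode x hx]
    ring
  have hx1 : Tendsto (fun x : ℝ => x) (𝓝[<] 1) (𝓝 1) := tendsto_id.mono_left nhdsWithin_le_nhds
  have hr1 : Tendsto (fun x : ℝ => x ^ (-α)) (𝓝[<] 1) (𝓝 1) := by
    simpa using hx1.rpow_const (p := -α) (Or.inl one_ne_zero)
  have hU₂c : ContinuousOn U₂ (Ioo 0 1) := by
    have hvc : ContinuousOn v (Ioo 0 1) := fun x hx => (hvd x hx).continuousAt.continuousWithinAt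
    have hhc : ContinuousOn h (Ioo 0 1) := fun x hx => (hhd x hx).continuousAt.continuousWithinAt
    have hne : ∀ j : ℕ, ∀ x ∈ Ioo (0 : ℝ) 1, x ^ j ≠ 0 := fun j x hx => pow_ne_zero j hx.1.ne'
    have hr : ContinuousOn (fun x : ℝ => x ^ (-α)) (Ioo 0 1) := fun x hx =>
      (Real.continuousAt_rpow_const x _ (Or.inl hx.1.ne')).continuousWithinAt
    exact hr.mul (((hqc.div (continuousOn_pow 4) (hne 4)).add
      ((hhc.const_mul _).div (continuousOn_pow 3) (hne 3))).add
      ((hvc.const_mul _).div (continuousOn_pow 2) (hne 2)))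
  have hone : ∀ j : ℕ, (1 : ℝ) ^ j ≠ 0 := fun j => by simp
  obtain ⟨u, hu, hEq, hu0, hu1, hu'⟩ := exists_contDiffOn_two_extension hd₀ hd₁ hU₂c hv₀
    (hr1.mul hv₁) hl₁
    (hr1.mul ((hh₁.neg.div (hx1.pow 2) (hone 2)).sub ((hv₁.const_mul α).div hx1 one_ne_zero))) hl₂
    (hr1.mul (((hq₁.div (hx1.pow 4) (hone 4)).add
      ((hh₁.const_mul (2 * α + 2)).div (hx1.pow 3) (hone 3))).add
      ((hv₁.const_mul (α * (α + 1))).div (hx1.pow 2) (hone 2))))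
  refine ⟨u, hu, hEq, hu0, by rw [hu1, one_mul], hu', fun x hx => ?_⟩
  have hev : ∀ x ∈ Ioo (0 : ℝ) 1, u =ᶠ[𝓝 x] U₀ := fun x hx => by
    filter_upwards [isOpen_Ioo.mem_nhds hx] with y hy using hEq hy
  have hd : ∀ x ∈ Ioo (0 : ℝ) 1, deriv u x = U₁ x := fun x hx => by
    rw [(hev x hx).deriv_eq, (hd₀ x hx).deriv]
  have hdd : deriv (deriv u) x = U₂ x := by
    have : deriv u =ᶠ[𝓝 x] U₁ := by
      filter_upwards [isOpen_Ioo.mem_nhds hx] with y hy using hd y hy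
    rw [this.deriv_eq, (hd₁ x hx).deriv]
  have hpos : 0 < U₀ x := mul_pos (Real.rpow_pos_of_pos hx.1 _) (hvpos x hx)
  have := hode x hx
  rw [rpow_eq_mul hp hpos.le] at this
  rw [hdd, hd x hx, hEq hx, abs_of_pos hpos]
  linear_combination this

lemma hasDerivAt_arcosh_inv {x : ℝ} (hx : x ∈ Ioo (0 : ℝ) 1) :
    HasDerivAt (fun x => Real.arcosh x⁻¹) (-1 / (x ^ 2 * Real.sinh (Real.arcosh x⁻¹))) x := by
  have h1 : 1 < x⁻¹ := (one_lt_inv₀ hx.1).2 hx.2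
  have := (Real.hasDerivAt_arcosh (mem_Ioi.2 h1)).comp x (hasDerivAt_inv hx.1.ne')
  convert! this using 1
  rw [Real.sinh_arcosh h1.le]
  field_simp

lemma arcosh_inv_pos {x : ℝ} (hx : x ∈ Ioo (0 : ℝ) 1) : 0 < Real.arcosh x⁻¹ :=
  Real.arcosh_pos ((one_lt_inv₀ hx.1).2 hx.2)

lemma cosh_arcosh_inv {x : ℝ} (hx : x ∈ Ioo (0 : ℝ) 1) : Real.cosh (Real.arcosh x⁻¹) = x⁻¹ :=
  Real.cosh_arcosh ((one_lt_inv₀ hx.1).2 hx.2).le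

lemma sinh_sq_arcosh_inv {x : ℝ} (hx : x ∈ Ioo (0 : ℝ) 1) :
    Real.sinh (Real.arcosh x⁻¹) ^ 2 = (1 - x ^ 2) / x ^ 2 := by
  rw [Real.sinh_sq, cosh_arcosh_inv hx]
  have := hx.1.ne'
  field_simp

lemma tendsto_arcosh_inv_nhdsLT_one :
    Tendsto (fun x : ℝ => Real.arcosh x⁻¹) (𝓝[<] 1) (𝓝[>] 0) := by
  have hm : Ioo (0 : ℝ) 1 ∈ 𝓝[<] (1 : ℝ) := Ioo_mem_nhdsLT one_pos
  refine tendsto_nhdsWithin_iff.2 ⟨?_, ?_⟩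
  · have h1 : Tendsto (fun x : ℝ => x⁻¹) (𝓝[<] 1) (𝓝[≥] 1) := by
      refine tendsto_nhdsWithin_iff.2 ⟨?_, ?_⟩
      · have := (tendsto_inv₀ (one_ne_zero (α := ℝ))).mono_left (nhdsWithin_le_nhds (s := Iio 1))
        simpa using this
      · filter_upwards [hm] with x hx using ((one_lt_inv₀ hx.1).2 hx.2).le
    have h2 := (Real.continuousOn_arcosh 1 (by simp)).tendsto
    rw [Real.arcosh_zero] at h2
    exact h2.comp h1
  · filter_upwards [hm] with x hx using arcosh_inv_pos hx

lemma tendsto_arcosh_inv_nhdsGT_zero :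
    Tendsto (fun x : ℝ => Real.arcosh x⁻¹) (𝓝[>] 0) atTop := by
  have h : Tendsto Real.arcosh atTop atTop := by
    refine tendsto_atTop.2 fun b => ?_
    filter_upwards [eventually_ge_atTop (Real.cosh b)] with x hx
    have h1 : 1 ≤ x := (Real.one_le_cosh b).trans hx
    have h2 : Real.cosh b ≤ Real.cosh (Real.arcosh x) := by rwa [Real.cosh_arcosh h1]
    rw [Real.cosh_le_cosh, abs_of_nonneg (Real.arcosh_nonneg h1)] at h2
    exact (le_abs_self b).trans h2
  exact h.comp tendsto_inv_nhdsGT_zero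

lemma tendsto_div_sinh {y : ℝ → ℝ} {l : ℝ} (h : Tendsto (fun t => y t / t) (𝓝[>] 0) (𝓝 l)) :
    Tendsto (fun t => y t / Real.sinh t) (𝓝[>] 0) (𝓝 l) := by
  have h1 : Tendsto (fun t => Real.sinh t / t) (𝓝[>] 0) (𝓝 1) := by
    have := (Real.hasDerivAt_sinh 0).tendsto_slope
    rw [Real.cosh_zero] at this
    refine (this.mono_left (nhdsWithin_mono 0 fun x hx => ne_of_gt hx)).congr fun x => ?_
    simp [slope_def_field]
  have := h.div h1 one_ne_zero
  rw [div_one] at this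
  refine this.congr' ?_
  filter_upwards [self_mem_nhdsWithin] with t ht
  have : t ≠ 0 := (mem_Ioi.1 ht).ne'
  simp only [Pi.div_apply]
  field_simp

section Connection

variable {p a k W : ℝ} {n : ℕ} {w y : ℝ → ℝ}

/-- The derivative of `y / sinh` along a connection, divided by `sinh`. -/
noncomputable def connectionCurvature (p a k : ℝ) (w y : ℝ → ℝ) (t : ℝ) : ℝ :=
  ((k - 1) * Real.cosh t * (y t / Real.sinh t) - (w t ^ p - a * w t)) / Real.sinh t ^ 2

lemma IsConnection.hasDerivAt_div_sinh (h : IsConnection p a k W n w y) {t : ℝ} (ht : 0 < t) :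
    HasDerivAt (fun t => y t / Real.sinh t)
      (connectionCurvature p a k w y t * Real.sinh t) t := by
  have hs : Real.sinh t ≠ 0 := (Real.sinh_pos_iff.2 ht).ne'
  have := (h.deriv_y t ht).div (Real.hasDerivAt_sinh t) hs
  convert! this using 1
  rw [connectionCurvature]
  field_simp
  ring

lemma IsConnection.tendsto_curvature (h : IsConnection p a k W n w y) (hp : 1 < p) (hk : k < 1) :
    ∃ l, Tendsto (connectionCurvature p a k w y) (𝓝[>] 0) (𝓝 l) := by
  have hw0 : Tendsto w (𝓝[>] 0) (𝓝 (w 0)) :=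
    (h.continuous_w.tendsto 0).mono_left nhdsWithin_le_nhds
  have hH := tendsto_div_sinh h.regular
  have hk1 : 1 - k ≠ 0 := by linarith
  have hc : Tendsto Real.cosh (𝓝[>] 0) (𝓝 1) := by
    simpa using (Real.continuous_cosh.tendsto 0).mono_left nhdsWithin_le_nhds
  have hs : Tendsto Real.sinh (𝓝[>] 0) (𝓝 0) := by
    simpa using (Real.continuous_sinh.tendsto 0).mono_left nhdsWithin_le_nhds
  set J : ℝ → ℝ := fun t =>
    (k - 1) * Real.cosh t * (y t / Real.sinh t) - (w t ^ p - a * w t) with hJ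
  have hJ0 : Tendsto J (𝓝[>] 0) (𝓝 0) := by
    have := ((hc.const_mul (k - 1)).mul hH).sub
      ((hw0.rpow_const (p := p) (Or.inr (by linarith))).sub (hw0.const_mul a))
    convert this using 2
    field_simp
    ring
  have hsp : ∀ {e : ℝ}, 0 < e → Tendsto (fun t => Real.sinh t ^ e) (𝓝[>] 0) (𝓝 0) := fun he => by
    simpa [Real.zero_rpow he.ne'] using hs.rpow_const (p := _) (Or.inr he.le)
  have hlop : ∃ l, Tendsto (fun t => J t * Real.sinh t ^ (1 - k) / Real.sinh t ^ (3 - k))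
      (𝓝[>] 0) (𝓝 l) := by
    have hl := ((((hw0.rpow_const (p := p - 1) (Or.inr (by linarith))).const_mul p).add_const
      (1 - k - a)).mul hH).neg.div (hc.const_mul (3 - k)) (by linarith)
    refine ⟨_, HasDerivAt.lhopital_zero_nhdsGT
      (f' := fun t => -Real.sinh t ^ (2 - k) *
        ((p * w t ^ (p - 1) + (1 - k - a)) * (y t / Real.sinh t)))
      (g' := fun t => (3 - k) * Real.sinh t ^ (2 - k) * Real.cosh t) ?_ ?_ ?_ ?_ ?_
      (hl.congr' ?_)⟩
    · filter_upwards [self_mem_nhdsWithin] with t ht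
      have ht : 0 < t := ht
      have hst := Real.sinh_pos_iff.2 ht
      have e := (((Real.hasDerivAt_cosh t).const_mul (k - 1)).mul (h.hasDerivAt_div_sinh ht)).sub
        ((hasDerivAt_rpow_sub hp a (w t)).comp t (h.deriv_w t ht))
      have e2 := e.mul ((Real.hasDerivAt_sinh t).rpow_const (p := 1 - k) (Or.inl hst.ne'))
      convert! e2 using 1
      have r1 : Real.sinh t ^ (1 - k) = Real.sinh t ^ (1 - k - 1) * Real.sinh t := by
        rw [← Real.rpow_add_one hst.ne']; ring_nf
      have r2 : Real.sinh t ^ (2 - k) = Real.sinh t ^ (1 - k - 1) * Real.sinh t ^ 2 := by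
        rw [← Real.rpow_add_natCast hst.ne']; push_cast; ring_nf
      simp only [connectionCurvature, Pi.sub_apply, Pi.mul_apply, Function.comp]
      rw [r1, r2]
      field_simp
      ring
    · filter_upwards [self_mem_nhdsWithin] with t ht
      have ht : 0 < t := ht
      have hst := Real.sinh_pos_iff.2 ht
      convert! (Real.hasDerivAt_sinh t).rpow_const (p := 3 - k) (Or.inl hst.ne') using 1
      rw [show 3 - k - 1 = 2 - k by ring]
      ring
    · filter_upwards [self_mem_nhdsWithin] with t ht
      have hst := Real.sinh_pos_iff.2 (mem_Ioi.1 ht)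
      have := Real.rpow_pos_of_pos hst (2 - k)
      have := Real.cosh_pos t
      have : 3 - k ≠ 0 := by linarith
      positivity
    · simpa using hJ0.mul (hsp (e := 1 - k) (by linarith))
    · exact hsp (by linarith)
    · filter_upwards [self_mem_nhdsWithin] with t ht
      have hst := Real.sinh_pos_iff.2 (mem_Ioi.1 ht)
      have := (Real.rpow_pos_of_pos hst (2 - k)).ne'
      have := (Real.cosh_pos t).ne'
      have : 3 - k ≠ 0 := by linarith
      simp only [Pi.div_apply]
      field_simp
  obtain ⟨l, hl⟩ := hlop
  refine ⟨l, hl.congr' ?_⟩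
  filter_upwards [self_mem_nhdsWithin] with t ht
  have hst := Real.sinh_pos_iff.2 (mem_Ioi.1 ht)
  have r : Real.sinh t ^ (3 - k) = Real.sinh t ^ (1 - k) * Real.sinh t ^ 2 := by
    rw [← Real.rpow_add_natCast hst.ne']; push_cast; ring_nf
  have := (Real.rpow_pos_of_pos hst (1 - k)).ne'
  rw [r, connectionCurvature]
  simp only [hJ]
  field_simp

end Connection

lemma exists_profile_of_isConnection {p α W : ℝ} {m n : ℕ} {w y : ℝ → ℝ} (hp : 1 < p)
    (hm : 1 ≤ m) (hα : 0 < α) (hαp : α * (p - 1) = 2) (hk : 0 < m - 1 - 2 * α)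
    (hk1 : m - 1 - 2 * α < 1)
    (h : IsConnection p (α * (m - 1 - α)) (m - 1 - 2 * α) W n w y) :
    ∃ C > 0, ∃ u : ℝ → ℝ, ContDiffOn ℝ 2 u (Icc 0 1) ∧
      EqOn u (fun x => x ^ (-α) * w (Real.arcosh x⁻¹)) (Ioo 0 1) ∧
      u 0 = C ∧ u 1 = w 0 ∧ derivWithin u (Ici 0) 0 = 0 ∧
      ∀ x ∈ Ioo (0 : ℝ) 1, (1 - x ^ 2) * deriv (deriv u) x +
        (m / x - 2 * (α + 1) * x) * deriv u x - α * (α + 1) * u x +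
          |u x| ^ (p - 1) * u x = 0 := by
  obtain ⟨hyw, C', hC', hwe⟩ := h.asymptotics hp hk hα hαp (by ring)
  obtain ⟨q₁, hq₁⟩ := h.tendsto_curvature hp hk1
  set k : ℝ := m - 1 - 2 * α with hk_def
  set a : ℝ := α * (m - 1 - α) with ha_def
  have hm0 : Ioo (0 : ℝ) 1 ∈ 𝓝[>] (0 : ℝ) := Ioo_mem_nhdsGT one_pos
  have hw0 : Tendsto w (𝓝[>] 0) (𝓝 (w 0)) :=
    (h.continuous_w.tendsto 0).mono_left nhdsWithin_le_nhds
  have hch : Tendsto (fun t => Real.cosh t ^ α * w t) atTop (𝓝 ((1 / 2) ^ α * C')) := by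
    have h1 : Tendsto (fun t => Real.cosh t * Real.exp (-t)) atTop (𝓝 (1 / 2)) := by
      have h2 := ((Real.tendsto_exp_neg_atTop_nhds_zero.pow 2).div_const 2).const_add (1 / 2 : ℝ)
      rw [zero_pow two_ne_zero, zero_div, add_zero] at h2
      refine h2.congr fun t => ?_
      have : Real.exp t * Real.exp (-t) = 1 := by rw [← Real.exp_add]; simp
      rw [Real.cosh_eq]
      linear_combination (-1 / 2) * this
    refine ((h1.rpow_const (p := α) (Or.inr hα.le)).mul hwe).congr fun t => ?_
    rw [Real.mul_rpow (Real.cosh_pos t).le (Real.exp_pos _).le, ← Real.exp_mul, mul_assoc,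
      mul_comm (w t), ← mul_assoc (Real.exp _), ← Real.exp_add]
    ring_nf
    simp
  have hrpow : ∀ x ∈ Ioo (0 : ℝ) 1, Real.cosh (Real.arcosh x⁻¹) ^ α = x ^ (-α) := fun x hx => by
    rw [cosh_arcosh_inv hx, Real.inv_rpow hx.1.le, Real.rpow_neg hx.1.le]
  refine ⟨(1 / 2) ^ α * C', by positivity, ?_⟩
  refine exists_profile_of_system (v := fun x => w (Real.arcosh x⁻¹))
    (h := fun x => y (Real.arcosh x⁻¹) / Real.sinh (Real.arcosh x⁻¹))
    (q := fun x => connectionCurvature p a k w y (Real.arcosh x⁻¹)) hm hp hαp ?_ ?_ ?_ ?_ ?_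
    (hw0.comp tendsto_arcosh_inv_nhdsLT_one)
    ((tendsto_div_sinh h.regular).comp tendsto_arcosh_inv_nhdsLT_one)
    (hq₁.comp tendsto_arcosh_inv_nhdsLT_one) ?_ ?_
  · intro x hx
    have ht := arcosh_inv_pos hx
    convert! (h.deriv_w _ ht).comp x (hasDerivAt_arcosh_inv hx) using 1
    have := (Real.sinh_pos_iff.2 ht).ne'
    have := hx.1.ne'
    field_simp
  · intro x hx
    have ht := arcosh_inv_pos hx
    convert! (h.hasDerivAt_div_sinh ht).comp x (hasDerivAt_arcosh_inv hx) using 1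
    have := (Real.sinh_pos_iff.2 ht).ne'
    have := hx.1.ne'
    generalize Real.arcosh x⁻¹ = τ at *
    field_simp
  · intro x hx
    have ht := arcosh_inv_pos hx
    have hs := (Real.sinh_pos_iff.2 ht).ne'
    have hτ := (hasDerivAt_arcosh_inv hx).continuousAt
    have hc : ContinuousAt (connectionCurvature p a k w y) (Real.arcosh x⁻¹) := by
      have hwc := (h.deriv_w _ ht).continuousAt
      have hsc := Real.continuous_sinh.continuousAt (x := Real.arcosh x⁻¹)
      exact ((((Real.continuous_cosh.continuousAt).const_mul (k - 1)).mul
        ((h.deriv_y _ ht).continuousAt.div hsc hs)).sub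
        ((hwc.rpow_const (Or.inr (by linarith))).sub (hwc.const_mul a))).div (hsc.pow 2)
        (pow_ne_zero 2 hs)
    exact (ContinuousAt.comp (f := fun x : ℝ => Real.arcosh x⁻¹) hc hτ).continuousWithinAt
  · exact fun x hx => h.pos _ (arcosh_inv_pos hx).le
  · intro x hx
    have := hx.1.ne'
    have h2 : 1 - x ^ 2 ≠ 0 := by nlinarith [hx.1, hx.2]
    simp only [connectionCurvature]
    rw [sinh_sq_arcosh_inv hx, cosh_arcosh_inv hx]
    field_simp
    rw [hk_def, ha_def]
    ring
  · refine (hch.comp tendsto_arcosh_inv_nhdsGT_zero).congr' ?_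
    filter_upwards [hm0] with x hx
    simp only [Function.comp, hrpow x hx]
  · have := ((hyw.mul hch).mul tendsto_coth_atTop).comp tendsto_arcosh_inv_nhdsGT_zero
    rw [mul_one] at this
    refine this.congr' ?_
    filter_upwards [hm0] with x hx
    have ht := arcosh_inv_pos hx
    have := (Real.sinh_pos_iff.2 ht).ne'
    have := (h.pos _ ht.le).ne'
    have := hx.1.ne'
    simp only [Function.comp, hrpow x hx]
    rw [cosh_arcosh_inv hx]
    generalize Real.arcosh x⁻¹ = τ at *
    field_simp

/-- In the logarithmic variable the crossings of the singular solution correspond to the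
crossings of the constant `W`. -/
lemma encard_setOf_rpow_mul_arcosh {α W : ℝ} {u w : ℝ → ℝ} (hW : 0 < W)
    (hu : EqOn u (fun x => x ^ (-α) * w (Real.arcosh x⁻¹)) (Ioo 0 1)) :
    {ρ ∈ Ioo (0 : ℝ) 1 | u ρ / (W * ρ ^ (-α)) - 1 = 0}.encard =
      {t | 0 < t ∧ w t = W}.encard := by
  have hmaps : ∀ t : ℝ, 0 < t → (Real.cosh t)⁻¹ ∈ Ioo (0 : ℝ) 1 := fun t ht =>
    ⟨inv_pos.2 (Real.cosh_pos t), inv_lt_one_of_one_lt₀ (Real.one_lt_cosh.2 ht.ne')⟩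
  have hiff : ∀ x ∈ Ioo (0 : ℝ) 1, u x / (W * x ^ (-α)) - 1 = 0 ↔
      w (Real.arcosh x⁻¹) = W := by
    intro x hx
    have := (Real.rpow_pos_of_pos hx.1 (-α)).ne'
    rw [hu hx, sub_eq_zero, mul_comm W, mul_div_mul_left _ _ this, div_eq_one_iff_eq hW.ne']
  have himg : {ρ ∈ Ioo (0 : ℝ) 1 | u ρ / (W * ρ ^ (-α)) - 1 = 0} =
      (fun t => (Real.cosh t)⁻¹) '' {t | 0 < t ∧ w t = W} := by
    ext x
    constructor
    · rintro ⟨hx, h⟩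
      refine ⟨Real.arcosh x⁻¹, ⟨arcosh_inv_pos hx, (hiff x hx).1 h⟩, ?_⟩
      simp only [cosh_arcosh_inv hx, inv_inv]
    · rintro ⟨t, ⟨ht, hwt⟩, rfl⟩
      refine ⟨hmaps t ht, (hiff _ (hmaps t ht)).2 ?_⟩
      rwa [inv_inv, Real.arcosh_cosh ht.le]
  rw [himg]
  refine InjOn.encard_image fun s hs t ht hst => ?_
  exact Real.cosh_injOn (le_of_lt hs.1) (le_of_lt ht.1) (inv_injective hst)

lemma parameter_bounds {N : ℕ} {p : ℝ}
    (hNp : (N = 3 ∧ 5 < p) ∨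
      (4 ≤ N ∧ 1 + 4 / ((N : ℝ) - 2) < p ∧ p < 1 + 4 / ((N : ℝ) - 3))) :
    3 ≤ N ∧ 1 < p ∧ 0 < alphaP p ∧ alphaP p * (p - 1) = 2 ∧ 0 < (N : ℝ) - 2 - 2 * alphaP p ∧
      (N : ℝ) - 2 - 2 * alphaP p < 1 ∧ 1 / 2 < (N : ℝ) - 2 - alphaP p := by
  have hp : 1 < p := by
    rcases hNp with ⟨-, h⟩ | ⟨hN, h, -⟩
    · linarith
    · have : (4 : ℝ) ≤ N := by exact_mod_cast hN
      have : 0 < 4 / ((N : ℝ) - 2) := div_pos (by norm_num) (by linarith)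
      linarith
  have hp0 : 0 < p - 1 := sub_pos.2 hp
  have hα : 0 < alphaP p := div_pos two_pos hp0
  have hαp : alphaP p * (p - 1) = 2 := div_mul_cancel₀ 2 hp0.ne'
  have hb : 3 ≤ N ∧ 0 < (N : ℝ) - 2 - 2 * alphaP p ∧ (N : ℝ) - 2 - 2 * alphaP p < 1 := by
    rcases hNp with ⟨rfl, h⟩ | ⟨hN, h1, h2⟩
    · norm_num
      constructor <;> nlinarith
    · have h4 : (4 : ℝ) ≤ N := by exact_mod_cast hN
      have h1 : 4 / ((N : ℝ) - 2) < p - 1 := by linarith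
      have h2 : p - 1 < 4 / ((N : ℝ) - 3) := by linarith
      rw [div_lt_iff₀ (by linarith)] at h1
      rw [lt_div_iff₀ (by linarith)] at h2
      refine ⟨by omega, ?_, ?_⟩ <;> nlinarith
  have : (3 : ℝ) ≤ N := by exact_mod_cast hb.1
  exact ⟨hb.1, hp, hα, hαp, hb.2.1, hb.2.2, by linarith⟩

theorem stmt10 (N : ℕ) (p : ℝ)
    (hNp : (N = 3 ∧ 5 < p) ∨
      (4 ≤ N ∧ 1 + 4 / ((N : ℝ) - 2) < p ∧ p < 1 + 4 / ((N : ℝ) - 3))) :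
    ∀ n : ℕ, 1 ≤ n →
      ∃ (B C : ℝ) (u : ℝ → ℝ),
        0 < B ∧ B < bInf N p ∧ 0 < C ∧
        ContDiffOn ℝ 2 u (Icc 0 1) ∧
        IsSolOn N p u (Ioo 0 1) ∧
        u 0 = C ∧ derivWithin u (Ici 0) 0 = 0 ∧ u 1 = B ∧
        (∀ x ∈ Icc (0 : ℝ) 1, 0 < u x) ∧
        {ρ ∈ Ioo (0 : ℝ) 1 | u ρ / uInf N p ρ - 1 = 0}.encard =
          ((2 * n : ℕ) : ℕ∞) := by
  obtain ⟨hN, hp, hα, hαp, hk, hk1, hbig⟩ := parameter_bounds hNp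
  obtain ⟨m, rfl⟩ : ∃ m, N = m + 1 := ⟨N - 1, by omega⟩
  intro n hn
  rw [show (((m + 1 : ℕ) : ℝ) - 2 - 2 * alphaP p) = m - 1 - 2 * alphaP p by push_cast; ring]
    at hk hk1
  rw [show (((m + 1 : ℕ) : ℝ) - 2 - alphaP p) = m - 1 - alphaP p by push_cast; ring] at hbig
  have ha : 0 < alphaP p * (m - 1 - alphaP p) := mul_pos hα (by linarith)
  have hW : bInf (m + 1) p = (alphaP p * (m - 1 - alphaP p)) ^ (alphaP p / 2) := by
    rw [bInf]; push_cast; ring_nf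
  have hWpos : 0 < bInf (m + 1) p := hW ▸ Real.rpow_pos_of_pos ha _
  have hWp : bInf (m + 1) p ^ (p - 1) = alphaP p * (m - 1 - alphaP p) := by
    rw [hW, ← Real.rpow_mul ha.le, show alphaP p / 2 * (p - 1) = 1 by linarith, Real.rpow_one]
  obtain ⟨w, y, h⟩ := exists_isConnection hp hWpos hWp (by nlinarith) hk hk1 hn
  obtain ⟨C, hC, u, hu, hEq, hu0, hu1, hu', hode⟩ :=
    exists_profile_of_isConnection hp (by omega) hα hαp hk hk1 h
  refine ⟨w 0, C, u, h.pos 0 le_rfl, h.w_zero_lt, hC, hu, ?_, hu0, hu', hu1, ?_, ?_⟩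
  · intro x hx
    have := hode x hx
    push_cast
    rwa [add_sub_cancel_right]
  · intro x hx
    rcases eq_or_lt_of_le hx.1 with rfl | hx0
    · rwa [hu0]
    rcases eq_or_lt_of_le hx.2 with rfl | hx1
    · rw [hu1]
      exact h.pos 0 le_rfl
    · rw [hEq ⟨hx0, hx1⟩]
      exact mul_pos (Real.rpow_pos_of_pos hx0 _) (h.pos _ (arcosh_inv_pos ⟨hx0, hx1⟩).le)
  · simp only [uInf]
    rw [encard_setOf_rpow_mul_arcosh hWpos hEq, h.encard_eq]
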